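/- arXiv:1708.04632 — 4 statements merged into one kernel-verified Lean document; each statement's English description precedes it below -/
import Mathlib

section
/- Let G be an almost well-covered finite simple graph of girth at least 6 with exactly one vertex of type 2. Then every connected component of G_0 is isomorphic to K_1, K_2, the path P_4 on four vertices, or the cycle C_7 on seven vertices. -/
/-- `s` is an independent set in `G`: no two vertices of `s` are adjacent. -/
def IndepSet {V : Type*} (G : SimpleGraph V) (s : Set V) : Prop :=
  ∀ ⦃a⦄, a ∈ s → ∀ ⦃b⦄, b ∈ s → ¬ G.Adj a b

/-- `s` is a maximal independent set in `G`. -/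
def MaxIndepSet {V : Type*} (G : SimpleGraph V) (s : Set V) : Prop :=
  IndepSet G s ∧ ∀ t : Set V, IndepSet G t → s ⊆ t → s = t

/-- `α(G)`: the maximum size of an independent set of `G`. -/
noncomputable def alphaNum {V : Type*} (G : SimpleGraph V) : ℕ :=
  sSup {n | ∃ s : Set V, IndepSet G s ∧ s.ncard = n}

/-- `i(G)`: the minimum size of a maximal independent set of `G`. -/
noncomputable def iNum {V : Type*} (G : SimpleGraph V) : ℕ :=
  sInf {n | ∃ s : Set V, MaxIndepSet G s ∧ s.ncard = n}

/-- The independence gap `μ_α(G) = α(G) - i(G)`. -/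
noncomputable def indepGap {V : Type*} (G : SimpleGraph V) : ℕ :=
  alphaNum G - iNum G

/-- `G` is well-covered: all maximal independent sets have the same size. -/
def WellCovered {V : Type*} (G : SimpleGraph V) : Prop :=
  alphaNum G = iNum G

/-- `G` is almost well-covered: its independence gap equals 1. -/
def AlmostWellCovered {V : Type*} (G : SimpleGraph V) : Prop :=
  indepGap G = 1

/-- The (open) neighborhood `N(I)` of a set of vertices `I`. -/
def nbhd {V : Type*} (G : SimpleGraph V) (I : Set V) : Set V :=
  {v | ∃ u ∈ I, G.Adj u v}

/-- `U(G)`: the set of vertices whose connected component induces a complete graph. -/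
def completeU {V : Type*} (G : SimpleGraph V) : Set V :=
  {u | G.IsClique (G.connectedComponentMk u).supp}

/-- A leaf: a vertex of the graph `G - U(G)` having degree 1 there. -/
def IsLeaf {V : Type*} (G : SimpleGraph V) (v : V) : Prop :=
  v ∉ completeU G ∧ {u | u ∉ completeU G ∧ G.Adj v u}.ncard = 1

/-- An internal vertex: a vertex of `G - U(G)` that is not a leaf. -/
def IsInternal {V : Type*} (G : SimpleGraph V) (v : V) : Prop :=
  v ∉ completeU G ∧ ¬ IsLeaf G v

/-- A vertex has type `k` if it is an internal vertex adjacent to exactly `k` leaves;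
in addition every vertex of `U(G)` has type `0`. -/
def HasType {V : Type*} (G : SimpleGraph V) (v : V) (k : ℕ) : Prop :=
  (IsInternal G v ∧ {u | IsLeaf G u ∧ G.Adj v u}.ncard = k) ∨ (v ∈ completeU G ∧ k = 0)

/-- The set of vertices of type `k`; `G_k` is the subgraph induced by this set. -/
def typeSet {V : Type*} (G : SimpleGraph V) (k : ℕ) : Set V :=
  {v | HasType G v k}

/-- The maximum number of vertices in a connected component of `G`. -/
noncomputable def maxCompCard {V : Type*} (G : SimpleGraph V) : ℕ :=
  sSup {n | ∃ c : G.ConnectedComponent, c.supp.ncard = n}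

/-- `G` has no cycle of length `n`. -/
def NoCycleOfLength {V : Type*} (G : SimpleGraph V) (n : ℕ) : Prop :=
  ∀ (v : V) (w : G.Walk v v), w.IsCycle → w.length ≠ n

/-- `G` has girth at least 6: no cycle of length 3, 4, or 5. -/
def GirthAtLeastSix {V : Type*} (G : SimpleGraph V) : Prop :=
  NoCycleOfLength G 3 ∧ NoCycleOfLength G 4 ∧ NoCycleOfLength G 5

/-- A pendant edge: an edge incident with a vertex of degree 1. -/
def pendantEdges {V : Type*} (G : SimpleGraph V) : Set (Sym2 V) :=
  {e | e ∈ G.edgeSet ∧ ∃ v ∈ e, (G.neighborSet v).ncard = 1}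

/-- The pendant edges of `G` are pairwise disjoint and cover every vertex of `G`. -/
def PendantPerfectMatching {V : Type*} (G : SimpleGraph V) : Prop :=
  (∀ e ∈ pendantEdges G, ∀ f ∈ pendantEdges G, e ≠ f → ∀ v : V, v ∈ e → v ∉ f) ∧
  (∀ v : V, ∃ e ∈ pendantEdges G, v ∈ e)

namespace SimpleGraph

variable {V : Type*} {G : SimpleGraph V}

/-- Short-cycle exclusions equivalent to girth at least six, in a form without walks. -/
structure NoShortCycle (G : SimpleGraph V) : Prop where
  no3 : ∀ {a b c}, G.Adj a b → G.Adj b c → G.Adj c a → False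
  no4 : ∀ {a b c d}, G.Adj a b → G.Adj b c → G.Adj c d → G.Adj d a → a ≠ c → b = d
  no5 : ∀ {a b c d e}, G.Adj a b → G.Adj b c → G.Adj c d → G.Adj d e → G.Adj e a → False

theorem _root_.GirthAtLeastSix.noShortCycle (hg : GirthAtLeastSix G) : NoShortCycle G := by
  obtain ⟨h3, h4, h5⟩ := hg
  have no3 : ∀ {a b c}, G.Adj a b → G.Adj b c → G.Adj c a → False := by
    intro a b c hab hbc hca
    refine h3 a (.cons hab (.cons hbc (.cons hca .nil))) ?_ rfl
    have := hab.ne; have := hbc.ne; have := hca.ne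
    simp [Walk.isCycle_def, Walk.isTrail_def]
    grind
  refine ⟨no3, ?_, ?_⟩
  · intro a b c d hab hbc hcd hda hac
    by_contra hbd
    refine h4 a (.cons hab (.cons hbc (.cons hcd (.cons hda .nil)))) ?_ rfl
    have := hab.ne; have := hbc.ne; have := hcd.ne; have := hda.ne
    simp [Walk.isCycle_def, Walk.isTrail_def]
    grind
  · intro a b c d e hab hbc hcd hde hea
    refine h5 a (.cons hab (.cons hbc (.cons hcd (.cons hde (.cons hea .nil))))) ?_ rfl
    have := hab.ne; have := hbc.ne; have := hcd.ne; have := hde.ne; have := hea.ne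
    have : a ≠ c := by rintro rfl; exact no3 hcd hde hea
    have : b ≠ d := by rintro rfl; exact no3 hde hea hab
    have : c ≠ e := by rintro rfl; exact no3 hea hab hbc
    have : d ≠ a := by rintro rfl; exact no3 hab hbc hcd
    have : e ≠ b := by rintro rfl; exact no3 hbc hcd hde
    simp [Walk.isCycle_def, Walk.isTrail_def]
    grind

/-- The finset `s` is independent. -/
def Indep (G : SimpleGraph V) (s : Finset V) : Prop :=
  ∀ a ∈ s, ∀ b ∈ s, ¬ G.Adj a b

/-- The vertex `v` lies in the closed neighbourhood of `A`. -/
def DominatedBy (G : SimpleGraph V) (A : Finset V) (v : V) : Prop :=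
  v ∈ A ∨ ∃ a ∈ A, G.Adj a v

/-- Within `W`, replacing an independent set `A` by an independent set `B` whose closed
neighbourhood is contained in that of `A` gains at most `k` vertices. For `k = 0` this says that
the subgraph induced by `W` is well-covered. -/
def GapLE (G : SimpleGraph V) (W : Finset V) (k : ℕ) : Prop :=
  ∀ A B : Finset V, A ⊆ W → B ⊆ W → G.Indep A → G.Indep B →
    (∀ b ∈ B, G.DominatedBy A b ∧ ∀ v ∈ W, G.Adj b v → G.DominatedBy A v) →
    B.card ≤ A.card + k

theorem GapLE.exchange [DecidableEq V] {W : Finset V} {k : ℕ} (h : G.GapLE W k)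
    (A B R : Finset V) (hAW : A ∪ R ⊆ W) (hBW : B ⊆ W) (hA : G.Indep (A ∪ R))
    (hB : G.Indep (B ∪ R)) (hBR : Disjoint B R)
    (hdom : ∀ b ∈ B, G.DominatedBy (A ∪ R) b ∧
      ∀ v ∈ W, G.Adj b v → G.DominatedBy (A ∪ R) v)
    (hRdom : ∀ b ∈ R, ∀ v ∈ W, G.Adj b v → G.DominatedBy (A ∪ R) v :=
      fun b hb _ _ hv => Or.inr ⟨b, Finset.mem_union_right _ hb, hv⟩) :
    B.card ≤ A.card + k := by
  have h1 := h (A ∪ R) (B ∪ R) hAW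
    (Finset.union_subset hBW (Finset.subset_union_right.trans hAW)) hA hB (by
      intro b hb
      rcases Finset.mem_union.1 hb with hb | hb
      · exact hdom b hb
      · exact ⟨Or.inl (Finset.mem_union_right _ hb), hRdom b hb⟩)
  have h2 := Finset.card_union_of_disjoint hBR
  have h3 := Finset.card_union_le A R
  omega

theorem GapLE.diff_closedNeighbor [DecidableEq V] {W W' : Finset V} {v : V} (h : G.GapLE W 0)
    (hv : v ∈ W) (hW' : ∀ u, u ∈ W' ↔ u ∈ W ∧ u ≠ v ∧ ¬ G.Adj v u) : G.GapLE W' 0 := by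
  intro A B hAW hBW hA hB hdom
  have hsub : ∀ {S : Finset V}, S ⊆ W' → S ∪ {v} ⊆ W := by
    intro S hS u hu
    rcases Finset.mem_union.1 hu with hu | hu
    · exact ((hW' u).1 (hS hu)).1
    · rw [Finset.mem_singleton.1 hu]; exact hv
  have hind : ∀ {S : Finset V}, S ⊆ W' → G.Indep S → G.Indep (S ∪ {v}) := by
    intro S hS hSi a ha b hb hab
    simp only [Finset.mem_union, Finset.mem_singleton] at ha hb
    rcases ha with ha | rfl <;> rcases hb with hb | rfl
    · exact hSi a ha b hb hab
    · exact ((hW' a).1 (hS ha)).2.2 hab.symm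
    · exact ((hW' b).1 (hS hb)).2.2 hab
    · exact hab.ne rfl
  have hmono : ∀ {u}, G.DominatedBy A u → G.DominatedBy (A ∪ {v}) u := by
    rintro u (hu | ⟨a, ha, hau⟩)
    · exact Or.inl (Finset.mem_union_left _ hu)
    · exact Or.inr ⟨a, Finset.mem_union_left _ ha, hau⟩
  refine h.exchange A B {v} (hsub hAW) (Finset.subset_union_left.trans (hsub hBW))
    (hind hAW hA) (hind hBW hB) ?_ ?_
  · rw [Finset.disjoint_singleton_right]
    exact fun hvB => ((hW' v).1 (hBW hvB)).2.1 rfl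
  · intro b hb
    refine ⟨hmono (hdom b hb).1, fun u hu hbu => ?_⟩
    by_cases huv : G.Adj v u
    · exact Or.inr ⟨v, by simp, huv⟩
    · by_cases h' : u = v
      · exact Or.inl (by simp [h'])
      · exact hmono ((hdom b hb).2 u ((hW' u).2 ⟨hu, h', huv⟩) hbu)

/-- `v` has exactly the two neighbours `y` and `a` in `W`. -/
structure TwoNeighbors (G : SimpleGraph V) (W : Finset V) (v y a : V) : Prop where
  mem : v ∈ W
  memL : y ∈ W
  memR : a ∈ W
  adjL : G.Adj v y
  adjR : G.Adj v a
  ne : y ≠ a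
  eq_or : ∀ u ∈ W, G.Adj v u → u = y ∨ u = a

theorem TwoNeighbors.symm {W : Finset V} {v y a : V} (h : G.TwoNeighbors W v y a) :
    G.TwoNeighbors W v a y :=
  ⟨h.mem, h.memR, h.memL, h.adjR, h.adjL, h.ne.symm, fun u hu hv => (h.eq_or u hu hv).symm⟩

/-- The minimum degree of the subgraph induced by `W` is at least two. -/
def MinDegTwo (G : SimpleGraph V) (W : Finset V) : Prop :=
  ∀ v ∈ W, ∀ u, ∃ w ∈ W, G.Adj v w ∧ w ≠ u

theorem TwoNeighbors.exists_opposite {W : Finset V} (hg : NoShortCycle G) (hW : G.GapLE W 0)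
    (hmin : G.MinDegTwo W) {v y a p s : V} (hv : G.TwoNeighbors W v y a)
    (hp : p ∈ W) (hap : G.Adj a p) (hpv : p ≠ v) (hs : s ∈ W) (hys : G.Adj y s) (hsv : s ≠ v) :
    ∃ r q, G.TwoNeighbors W r s q ∧ G.Adj q p ∧ ¬ G.Adj r p ∧ r ≠ y := by
  classical
  by_contra hcon
  have key : ∀ r, ∃ q, r ∈ W → G.Adj s r → r ≠ y → ¬ G.Adj r p →
      q ∈ W ∧ G.Adj r q ∧ q ≠ s ∧ ¬ G.Adj q p := by
    intro r
    by_contra! hno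
    obtain ⟨hr, hsr, hry, hrp, -⟩ := hno s
    obtain ⟨q, hq, hrq, hqs⟩ := hmin r hr s
    have hqp := (hno q).2.2.2.2 hq hrq hqs
    refine hcon ⟨r, q, ⟨hr, hs, hq, hsr.symm, hrq, hqs.symm, fun u hu hru => ?_⟩, hqp, hrp, hry⟩
    by_contra! hne
    have hup := (hno u).2.2.2.2 hu hru hne.1
    by_cases hrp' : r = p
    · subst hrp'
      exact hg.no5 hv.adjL hys hsr hap.symm hv.adjR.symm
    · exact hne.2 (hg.no4 hru hup hqp.symm hrq.symm hrp')
  choose q hq using key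
  have hsp : ¬ G.Adj s p := fun h => hg.no5 hv.adjL hys h hap.symm hv.adjR.symm
  have hyp : ¬ G.Adj y p := fun h => hpv (hg.no4 h hap.symm hv.adjR.symm hv.adjL hv.ne)
  have hps : p ≠ s := by
    rintro rfl; exact hyp hys
  set S := W.filter fun r => G.Adj s r ∧ r ≠ y ∧ ¬ G.Adj r p with hS
  have hS' : ∀ r ∈ S, G.Adj s r ∧ r ≠ y ∧ q r ∈ W ∧ G.Adj r (q r) ∧ q r ≠ s ∧ ¬ G.Adj (q r) p ∧
      q r ≠ v ∧ r ≠ p := by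
    intro r hr
    simp only [hS, Finset.mem_filter] at hr
    obtain ⟨hr, hsr, hry, hrp⟩ := hr
    obtain ⟨h1, h2, h3, h4⟩ := hq r hr hsr hry hrp
    refine ⟨hsr, hry, h1, h2, h3, h4, ?_, ?_⟩
    · rintro h5
      rw [h5] at h2
      rcases hv.eq_or r hr h2.symm with rfl | rfl
      · exact hry rfl
      · exact hrp hap
    · rintro rfl; exact hsp hsr
  have hR : G.Indep (insert p (S.image q)) := by
    intro b hb c hc hbc
    simp only [Finset.mem_insert, Finset.mem_image] at hb hc
    rcases hb with rfl | ⟨r, hr, rfl⟩ <;> rcases hc with rfl | ⟨r', hr', rfl⟩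
    · exact hbc.ne rfl
    · exact (hS' r' hr').2.2.2.2.2.1 hbc.symm
    · exact (hS' r hr).2.2.2.2.2.1 hbc
    · exact hg.no5 (hS' r hr).1 (hS' r hr).2.2.2.1 hbc (hS' r' hr').2.2.2.1.symm
        (hS' r' hr').1.symm
  have hyR : ∀ b ∈ insert p (S.image q), ¬ G.Adj y b := by
    intro b hb hyb
    simp only [Finset.mem_insert, Finset.mem_image] at hb
    rcases hb with rfl | ⟨r, hr, rfl⟩
    · exact hyp hyb
    · have h := hS' r hr
      exact h.2.1 (hg.no4 h.1 h.2.2.2.1 hyb.symm hys h.2.2.2.2.1.symm)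
  have hvR : ∀ b ∈ insert p (S.image q), ¬ G.Adj v b := by
    intro b hb hvb
    simp only [Finset.mem_insert, Finset.mem_image] at hb
    rcases hb with rfl | ⟨r, hr, rfl⟩
    · exact hg.no3 hvb hap.symm hv.adjR.symm
    · have h := hS' r hr
      exact hg.no5 hv.adjL hys h.1 h.2.2.2.1 hvb.symm
  have hsR : ∀ b ∈ insert p (S.image q), ¬ G.Adj s b := by
    intro b hb hsb
    simp only [Finset.mem_insert, Finset.mem_image] at hb
    rcases hb with rfl | ⟨r, hr, rfl⟩
    · exact hsp hsb
    · have h := hS' r hr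
      exact hg.no3 h.1 h.2.2.2.1 hsb.symm
  have hvs : ¬ G.Adj v s := fun h => hg.no3 h hys.symm hv.adjL.symm
  have := hW.exchange {y} {v, s} (insert p (S.image q)) ?_ ?_ ?_ ?_ ?_ ?_
  · rw [Finset.card_pair hsv.symm, Finset.card_singleton] at this
    omega
  · intro b hb
    simp only [Finset.mem_insert, Finset.mem_image, Finset.mem_union, Finset.mem_singleton] at hb
    rcases hb with rfl | rfl | ⟨r, hr, rfl⟩
    exacts [hv.memL, hp, (hS' r hr).2.2.1]
  · intro b hb
    simp only [Finset.mem_insert, Finset.mem_singleton] at hb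
    rcases hb with rfl | rfl
    exacts [hv.mem, hs]
  · intro b hb c hc hbc
    rw [Finset.mem_union, Finset.mem_singleton] at hb hc
    rcases hb with rfl | hb <;> rcases hc with rfl | hc
    · exact hbc.ne rfl
    · exact hyR c hc hbc
    · exact hyR b hb hbc.symm
    · exact hR b hb c hc hbc
  · intro b hb c hc hbc
    rw [Finset.mem_union, Finset.mem_insert, Finset.mem_singleton] at hb hc
    rcases hb with (rfl | rfl) | hb <;> rcases hc with (rfl | rfl) | hc
    · exact hbc.ne rfl
    · exact hvs hbc
    · exact hvR c hc hbc
    · exact hvs hbc.symm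
    · exact hbc.ne rfl
    · exact hsR c hc hbc
    · exact hvR b hb hbc.symm
    · exact hsR b hb hbc.symm
    · exact hR b hb c hc hbc
  · rw [Finset.disjoint_left]
    intro b hb hb'
    simp only [Finset.mem_insert, Finset.mem_image, Finset.mem_singleton] at hb hb'
    rcases hb' with rfl | ⟨r, hr, rfl⟩
    · exact hb.elim hpv hps
    · exact hb.elim (hS' r hr).2.2.2.2.2.2.1 (hS' r hr).2.2.2.2.1
  · have hy : y ∈ ({y} : Finset V) ∪ insert p (S.image q) := by simp
    have hp' : p ∈ ({y} : Finset V) ∪ insert p (S.image q) := by simp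
    intro b hb
    rw [Finset.mem_insert, Finset.mem_singleton] at hb
    rcases hb with rfl | rfl
    · refine ⟨Or.inr ⟨y, hy, hv.adjL.symm⟩, fun u hu hbu => ?_⟩
      rcases hv.eq_or u hu hbu with rfl | rfl
      · exact Or.inl hy
      · exact Or.inr ⟨p, hp', hap.symm⟩
    · refine ⟨Or.inr ⟨y, hy, hys⟩, fun u hu hbu => ?_⟩
      by_cases huy : u = y
      · exact Or.inl (huy ▸ hy)
      by_cases hup : G.Adj u p
      · exact Or.inr ⟨p, hp', hup.symm⟩
      have huS : u ∈ S := by simp [hS, hu, hbu, huy, hup]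
      refine Or.inr ⟨q u, ?_, (hS' u huS).2.2.2.1.symm⟩
      exact Finset.mem_union_right _ (Finset.mem_insert_of_mem (Finset.mem_image_of_mem q huS))

theorem TwoNeighbors.exists_right {W : Finset V} (hg : NoShortCycle G) (hW : G.GapLE W 0)
    (hmin : G.MinDegTwo W) {v y a : V} (hv : G.TwoNeighbors W v y a) :
    ∃ p, G.TwoNeighbors W a v p := by
  classical
  obtain ⟨p, hp, hap, hpv⟩ := hmin a hv.memR v
  refine ⟨p, hv.memR, hv.mem, hp, hv.adjR.symm, hap, hpv.symm, fun p' hp' hap' => ?_⟩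
  by_contra! hne
  obtain ⟨hp'v, hp'p⟩ := hne
  have key : ∀ s, ∃ r q, s ∈ W → G.Adj y s → s ≠ v →
      G.TwoNeighbors W r s q ∧ G.Adj q p ∧ ¬ G.Adj r p ∧ r ≠ y := by
    intro s
    by_cases hs : s ∈ W ∧ G.Adj y s ∧ s ≠ v
    · obtain ⟨r, q, h⟩ := hv.exists_opposite hg hW hmin hp hap hpv hs.1 hs.2.1 hs.2.2
      exact ⟨r, q, fun _ _ _ => h⟩
    · exact ⟨v, v, fun h1 h2 h3 => (hs ⟨h1, h2, h3⟩).elim⟩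
  choose r q hrq using key
  set S := W.filter fun s => G.Adj y s ∧ s ≠ v with hS
  have memS : ∀ {s}, s ∈ S ↔ s ∈ W ∧ G.Adj y s ∧ s ≠ v := by simp [hS]
  have hr : ∀ {s}, s ∈ S → G.TwoNeighbors W (r s) s (q s) := fun h =>
    (hrq _ (memS.1 h).1 (memS.1 h).2.1 (memS.1 h).2.2).1
  have hqp : ∀ {s}, s ∈ S → G.Adj (q s) p := fun h =>
    (hrq _ (memS.1 h).1 (memS.1 h).2.1 (memS.1 h).2.2).2.1
  have hrp : ∀ {s}, s ∈ S → ¬ G.Adj (r s) p := fun h =>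
    (hrq _ (memS.1 h).1 (memS.1 h).2.1 (memS.1 h).2.2).2.2.1
  have hry : ∀ {s}, s ∈ S → r s ≠ y := fun h =>
    (hrq _ (memS.1 h).1 (memS.1 h).2.1 (memS.1 h).2.2).2.2.2
  have hyS : ∀ {s}, s ∈ S → G.Adj y s := fun h => (memS.1 h).2.1
  have hSp : ∀ {s}, s ∈ S → ¬ G.Adj s p := fun h h' =>
    hg.no5 hv.adjL (hyS h) h' hap.symm hv.adjR.symm
  have hya : ∀ {z}, G.Adj y z → G.Adj a z → z = v := fun h h' =>
    hg.no4 h h'.symm hv.adjR.symm hv.adjL hv.ne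
  have har : ∀ {s}, s ∈ S → ¬ G.Adj a (r s) := fun h h' =>
    hg.no5 hv.adjL (hyS h) (hr h).adjL.symm h'.symm hv.adjR.symm
  set U := W.filter fun u => G.Adj p u ∧ u ≠ a ∧ u ∉ S.image q with hU
  have memU : ∀ {u}, u ∈ U ↔ u ∈ W ∧ G.Adj p u ∧ u ≠ a ∧ u ∉ S.image q := by simp [hU]
  have keyU : ∀ u, ∃ n, u ∈ U → n ∈ W ∧ G.Adj u n ∧ n ≠ p := by
    intro u
    by_cases hu : u ∈ U
    · obtain ⟨n, h1, h2, h3⟩ := hmin u (memU.1 hu).1 p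
      exact ⟨n, fun _ => ⟨h1, h2, h3⟩⟩
    · exact ⟨u, fun h => (hu h).elim⟩
  choose n hn using keyU
  have hpU : ∀ {u}, u ∈ U → G.Adj p u := fun h => (memU.1 h).2.1
  have hyn : ∀ {u}, u ∈ U → ¬ G.Adj y (n u) := by
    intro u hu hyn
    by_cases hnv : n u = v
    · have huv := (hn u hu).2.1
      rw [hnv] at huv
      rcases hv.eq_or u (memU.1 hu).1 huv.symm with rfl | rfl
      · exact hpv (hya (hpU hu).symm hap)
      · exact (memU.1 hu).2.2.1 rfl
    · have hnS : n u ∈ S := memS.2 ⟨(hn u hu).1, hyn, hnv⟩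
      exact hg.no5 (hpU hu) (hn u hu).2.1 (hr hnS).adjL.symm (hr hnS).adjR (hqp hnS)
  set R : Finset V := insert y (insert p' (U.image n)) with hRdef
  have memR : ∀ {b}, b ∈ R ↔ b = y ∨ b = p' ∨ ∃ u ∈ U, n u = b := by simp [hRdef]
  have hR : G.Indep R := by
    intro b hb c hc hbc
    rcases memR.1 hb with rfl | rfl | ⟨u, hu, rfl⟩ <;>
      rcases memR.1 hc with rfl | rfl | ⟨u', hu', rfl⟩
    · exact hbc.ne rfl
    · exact hp'v (hya hbc hap')
    · exact hyn hu' hbc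
    · exact hp'v (hya hbc.symm hap')
    · exact hbc.ne rfl
    · exact hg.no5 hap' hbc (hn u' hu').2.1.symm (hpU hu').symm hap.symm
    · exact hyn hu hbc.symm
    · exact hg.no5 hap' hbc.symm (hn u hu).2.1.symm (hpU hu).symm hap.symm
    · exact hg.no5 (hn u hu).2.1 hbc (hn u' hu').2.1.symm (hpU hu').symm (hpU hu)
  have hqR : ∀ {s}, s ∈ S → ∀ b ∈ R, ¬ G.Adj (q s) b := by
    intro s hs b hb hqb
    rcases memR.1 hb with rfl | rfl | ⟨u, hu, rfl⟩
    · exact hry hs (hg.no4 (hr hs).adjL.symm (hr hs).adjR hqb (hyS hs) (hr hs).ne)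
    · have : a = q s := hg.no4 hap'.symm hap (hqp hs).symm hqb hp'p
      exact har hs (this ▸ (hr hs).adjR.symm)
    · have : q s = u := hg.no4 (hqp hs).symm hqb (hn u hu).2.1.symm (hpU hu).symm
        (hn u hu).2.2.symm
      exact (memU.1 hu).2.2.2 (this ▸ Finset.mem_image_of_mem q hs)
  have hpR : ∀ b ∈ R, ¬ G.Adj p b := by
    intro b hb hpb
    rcases memR.1 hb with rfl | rfl | ⟨u, hu, rfl⟩
    · exact hpv (hya hpb.symm hap)
    · exact hg.no3 hap hpb hap'.symm
    · exact hg.no3 hpb (hn u hu).2.1.symm (hpU hu).symm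
  have hrR : ∀ {s}, s ∈ S → ∀ b ∈ R, ¬ G.Adj (r s) b := by
    intro s hs b hb hrb
    rcases memR.1 hb with rfl | rfl | ⟨u, hu, rfl⟩
    · exact hg.no3 (hyS hs) (hr hs).adjL.symm hrb
    · rcases (hr hs).eq_or _ hp' hrb with h | h
      · exact hp'v (hya (h ▸ hyS hs) hap')
      · exact hg.no3 hap (h ▸ (hqp hs).symm) hap'.symm
    · rcases (hr hs).eq_or _ (hn u hu).1 hrb with h | h
      · exact hyn hu (h ▸ hyS hs)
      · exact hg.no3 (hpU hu) (hn u hu).2.1 (h ▸ hqp hs)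
  have hrinj : Set.InjOn r S := by
    intro s hs s' hs' h
    have h' : G.Adj (r s) s' := h ▸ (hr hs').adjL
    rcases (hr hs).eq_or s' (memS.1 hs').1 h' with h | h
    · exact h.symm
    · exact (hSp hs' (h ▸ hqp hs)).elim
  have hpr : p ∉ S.image r := by
    intro h
    obtain ⟨s, hs, h⟩ := Finset.mem_image.1 h
    exact hSp hs (h ▸ (hr hs).adjL.symm)
  have hcard := hW.exchange (S.image q) (insert p (S.image r)) R ?_ ?_ ?_ ?_ ?_ ?_
  · rw [Finset.card_insert_of_notMem hpr, Finset.card_image_of_injOn hrinj] at hcard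
    have := Finset.card_image_le (s := S) (f := q)
    omega
  · intro b hb
    rcases Finset.mem_union.1 hb with hb | hb
    · obtain ⟨s, hs, rfl⟩ := Finset.mem_image.1 hb
      exact (hr hs).memR
    · rcases memR.1 hb with rfl | rfl | ⟨u, hu, rfl⟩
      exacts [hv.memL, hp', (hn u hu).1]
  · intro b hb
    rcases Finset.mem_insert.1 hb with rfl | hb
    · exact hp
    · obtain ⟨s, hs, rfl⟩ := Finset.mem_image.1 hb
      exact (hr hs).mem
  · intro b hb c hc hbc
    rw [Finset.mem_union, Finset.mem_image] at hb hc
    rcases hb with ⟨s, hs, rfl⟩ | hb <;> rcases hc with ⟨s', hs', rfl⟩ | hc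
    · exact hg.no3 (hqp hs).symm hbc (hqp hs')
    · exact hqR hs c hc hbc
    · exact hqR hs' b hb hbc.symm
    · exact hR b hb c hc hbc
  · intro b hb c hc hbc
    rw [Finset.mem_union, Finset.mem_insert, Finset.mem_image] at hb hc
    rcases hb with (rfl | ⟨s, hs, rfl⟩) | hb <;> rcases hc with (rfl | ⟨s', hs', rfl⟩) | hc
    · exact hbc.ne rfl
    · exact hrp hs' hbc.symm
    · exact hpR c hc hbc
    · exact hrp hs hbc
    · rcases (hr hs).eq_or _ (hr hs').mem hbc with h | h
      · exact hg.no3 (hyS hs) (h ▸ (hr hs').adjL) (hyS hs').symm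
      · exact hrp hs' (h ▸ hqp hs)
    · exact hrR hs c hc hbc
    · exact hpR b hb hbc.symm
    · exact hrR hs' b hb hbc.symm
    · exact hR b hb c hc hbc
  · rw [Finset.disjoint_left]
    intro b hb hbR
    rw [Finset.mem_insert, Finset.mem_image] at hb
    rcases hb with rfl | ⟨s, hs, rfl⟩ <;> rcases memR.1 hbR with h | h | ⟨u, hu, h⟩
    · exact hg.no3 hv.adjL (h ▸ hap.symm) hv.adjR.symm
    · exact hp'p h.symm
    · exact (hn u hu).2.2 h
    · exact hry hs h
    · exact har hs (h ▸ hap')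
    · rcases (hr hs).eq_or u (memU.1 hu).1 (h ▸ (hn u hu).2.1.symm) with h' | h'
      · exact hSp hs (h' ▸ (hpU hu).symm)
      · exact (memU.1 hu).2.2.2 (h' ▸ Finset.mem_image_of_mem q hs)
  · have hy : y ∈ S.image q ∪ R := Finset.mem_union_right _ (memR.2 (Or.inl rfl))
    have hp'R : p' ∈ S.image q ∪ R := Finset.mem_union_right _ (memR.2 (Or.inr (Or.inl rfl)))
    have hqm : ∀ {s}, s ∈ S → q s ∈ S.image q ∪ R := fun h =>
      Finset.mem_union_left _ (Finset.mem_image_of_mem q h)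
    intro b hb
    rw [Finset.mem_insert, Finset.mem_image] at hb
    rcases hb with rfl | ⟨s, hs, rfl⟩
    · obtain ⟨s, hsW, hys, hsv⟩ := hmin y hv.memL v
      have hs : s ∈ S := memS.2 ⟨hsW, hys, hsv⟩
      refine ⟨Or.inr ⟨q s, hqm hs, hqp hs⟩, fun u hu hbu => ?_⟩
      by_cases hua : u = a
      · exact Or.inr ⟨p', hp'R, hua ▸ hap'.symm⟩
      by_cases huq : u ∈ S.image q
      · exact Or.inl (Finset.mem_union_left _ huq)
      have huU : u ∈ U := memU.2 ⟨hu, hbu, hua, huq⟩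
      exact Or.inr ⟨n u, Finset.mem_union_right _ (memR.2 (Or.inr (Or.inr ⟨u, huU, rfl⟩))),
        (hn u huU).2.1.symm⟩
    · refine ⟨Or.inr ⟨q s, hqm hs, (hr hs).adjR.symm⟩, fun u hu hbu => ?_⟩
      rcases (hr hs).eq_or u hu hbu with rfl | rfl
      · exact Or.inr ⟨y, hy, hyS hs⟩
      · exact Or.inl (hqm hs)

theorem TwoNeighbors.exists_of_adj {W : Finset V} (hg : NoShortCycle G) (hW : G.GapLE W 0)
    (hmin : G.MinDegTwo W) {v y a w : V} (hv : G.TwoNeighbors W v y a) (hw : w ∈ W)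
    (hvw : G.Adj v w) : ∃ p, G.TwoNeighbors W w v p := by
  rcases hv.eq_or w hw hvw with rfl | rfl
  · exact hv.symm.exists_right hg hW hmin
  · exact hv.exists_right hg hW hmin

/-- `z` traverses a 7-cycle forming a connected component of the subgraph induced by `W`. -/
structure IsHeptagon (G : SimpleGraph V) (W : Finset V) (z : Fin 7 → V) : Prop where
  inj : Function.Injective z
  two : ∀ i, G.TwoNeighbors W (z i) (z (i + 1)) (z (i + 6))

theorem IsHeptagon.rotate {W : Finset V} {z : Fin 7 → V} (h : G.IsHeptagon W z) (k : Fin 7) :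
    G.IsHeptagon W fun i => z (i + k) where
  inj i j hij := add_right_cancel (h.inj hij)
  two i := by
    have := h.two (i + k)
    rwa [add_right_comm i k 1, add_right_comm i k 6] at this

theorem TwoNeighbors.exists_heptagon {W : Finset V} (hg : NoShortCycle G) (hW : G.GapLE W 0)
    (hmin : G.MinDegTwo W) {v y a : V} (hv : G.TwoNeighbors W v y a) :
    ∃ z, G.IsHeptagon W z ∧ z 0 = v := by
  obtain ⟨s, hy⟩ := hv.exists_of_adj hg hW hmin hv.memL hv.adjL
  obtain ⟨p, ha⟩ := hv.exists_of_adj hg hW hmin hv.memR hv.adjR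
  obtain ⟨r, q, hr, hqp, hrp, hry⟩ := hv.exists_opposite hg hW hmin ha.memR ha.adjR ha.ne.symm
    hy.memR hy.adjR hy.ne.symm
  obtain ⟨y', hs⟩ := hr.exists_of_adj hg hW hmin hr.memL hr.adjL
  obtain ⟨p', hq⟩ := hr.exists_of_adj hg hW hmin hr.memR hr.adjR
  obtain ⟨q', hp⟩ := ha.exists_of_adj hg hW hmin ha.memR ha.adjR
  obtain rfl : y = y' := (hs.eq_or y hv.memL hy.adjR.symm).resolve_left hry.symm
  obtain rfl : p = p' := by
    refine (hq.eq_or p ha.memR hqp).resolve_left ?_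
    rintro rfl
    exact hg.no5 hv.adjL hy.adjR hs.adjL ha.adjR.symm hv.adjR.symm
  obtain rfl : q = q' := by
    refine (hp.eq_or q hr.memR hqp.symm).resolve_left ?_
    rintro rfl
    exact hg.no5 hv.adjL hy.adjR hs.adjL hr.adjR ha.adjL
  refine ⟨![v, y, s, r, q, p, a], ⟨?_, ?_⟩, rfl⟩
  · have h1 := hv.adjL.ne
    have h2 := hy.adjR.ne
    have h3 := hr.adjL.ne
    have h4 := hr.adjR.ne
    have h5 := hqp.ne
    have h6 := ha.adjR.ne
    have h7 := hv.adjR.ne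
    have d1 := hv.ne; have d2 := hy.ne; have d3 := hs.ne; have d4 := hr.ne
    have d5 := hq.ne; have d6 := hp.ne; have d7 := ha.ne
    have e1 : v ≠ r := by rintro rfl; exact hg.no3 hy.adjR hs.adjL hv.adjL
    have e2 : v ≠ q := by rintro rfl; exact hry (hg.no4 hv.adjL hy.adjR hs.adjL hr.adjR d2).symm
    have e3 : y ≠ q := by rintro rfl; exact hg.no3 hy.adjR hs.adjL hr.adjR
    have e4 : y ≠ p := by rintro rfl; exact hg.no3 hv.adjL hp.adjL ha.adjL
    have e5 : s ≠ p := by rintro rfl; exact hg.no3 hs.adjL hr.adjR hqp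
    have e6 : s ≠ a := by rintro rfl; exact hg.no3 hv.adjL hy.adjR ha.adjL
    have e7 : r ≠ a := by rintro rfl; exact hg.no3 hr.adjR hqp hp.adjL
    rw [← List.nodup_ofFn]
    simp
    grind
  · intro i
    fin_cases i
    exacts [hv, hy.symm, hs, hr.symm, hq.symm, hp, ha]

/-- `l` has degree one in the subgraph induced by `W`, with unique neighbour `t`. -/
structure LeafIn (G : SimpleGraph V) (W : Finset V) (l t : V) : Prop where
  mem : l ∈ W
  mem_stem : t ∈ W
  adj : G.Adj l t
  eq_stem : ∀ u ∈ W, G.Adj l u → u = t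

theorem IsHeptagon.exists_eq_of_adj {W : Finset V} {z : Fin 7 → V} (hz : G.IsHeptagon W z)
    {i : Fin 7} {u : V} (hu : u ∈ W) (hzu : G.Adj (z i) u) : ∃ j, z j = u := by
  rcases (hz.two i).eq_or u hu hzu with h | h <;> exact ⟨_, h.symm⟩

theorem IsHeptagon.not_leafIn {W : Finset V} {z : Fin 7 → V} (hz : G.IsHeptagon W z)
    {i : Fin 7} {t : V} : ¬ G.LeafIn W (z i) t := fun h =>
  (hz.two i).ne ((h.eq_stem _ (hz.two i).memL (hz.two i).adjL).trans
    (h.eq_stem _ (hz.two i).memR (hz.two i).adjR).symm)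

/-- In the subgraph induced by `W`, the vertex `v` is isolated, or incident with a pendant edge,
or its connected component is a 7-cycle. -/
def Tame (G : SimpleGraph V) (W : Finset V) (v : V) : Prop :=
  (∀ u ∈ W, ¬ G.Adj v u) ∨ (∃ w, G.LeafIn W v w ∨ G.LeafIn W w v) ∨
    ∃ z, G.IsHeptagon W z ∧ z 0 = v

theorem LeafIn.unique {W : Finset V} (hg : NoShortCycle G) (hW : G.GapLE W 0) {l l' t : V}
    (h : G.LeafIn W l t) (h' : G.LeafIn W l' t) : l = l' := by
  classical
  by_contra hne
  have hll : ¬ G.Adj l l' := fun hl => hg.no3 hl h'.adj h.adj.symm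
  have := hW {t} {l, l'} (by simp [h.mem_stem])
    (by simp [Finset.insert_subset_iff, h.mem, h'.mem])
    (by simp [Indep]) (by simp [Indep, hll, G.adj_comm l' l]) ?_
  · rw [Finset.card_pair hne, Finset.card_singleton] at this
    omega
  · intro b hb
    have hb' : G.LeafIn W b t := by
      rcases Finset.mem_insert.1 hb with rfl | hb
      · exact h
      · rwa [Finset.mem_singleton.1 hb]
    exact ⟨Or.inr ⟨t, by simp, hb'.adj.symm⟩, fun u hu hbu => Or.inl (by
      simp [hb'.eq_stem u hu hbu])⟩

theorem MinDegTwo.exists_four_neighbors {W : Finset V} (hg : NoShortCycle G) (hW : G.GapLE W 0)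
    (hmin : G.MinDegTwo W)
    (ih : ∀ W' : Finset V, W'.card < W.card → G.GapLE W' 0 → ∀ v ∈ W', G.Tame W' v)
    {v y u : V} (hv : v ∈ W) (hy : y ∈ W) (hu : u ∈ W) (hvy : G.Adj v y) (hyu : G.Adj y u)
    (huv : u ≠ v) (hnot : ¬ ∃ b c, G.TwoNeighbors W v b c) :
    (∃ f : Fin 4 → V, Function.Injective f ∧ ∀ i, f i ∈ W ∧ G.Adj v (f i)) ∧
      ∃ s : Finset V, s.card ≤ 3 ∧ ∀ w ∈ W, G.Adj u w → w ∈ s := by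
  classical
  set W' := W.filter fun w => w ≠ v ∧ ¬ G.Adj v w with hW'def
  have memW' : ∀ w, w ∈ W' ↔ w ∈ W ∧ w ≠ v ∧ ¬ G.Adj v w := by simp [hW'def]
  have hlt : W'.card < W.card := Finset.card_lt_card <| Finset.ssubset_iff_of_subset
    (Finset.filter_subset _ _) |>.2 ⟨v, hv, fun h => ((memW' v).1 h).2.1 rfl⟩
  have huW' : u ∈ W' := (memW' u).2 ⟨hu, huv, fun h => hg.no3 hvy hyu h.symm⟩
  have hprop : ∀ {w w'}, (∃ b c, G.TwoNeighbors W w b c) → w' ∈ W → G.Adj w w' →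
      ∃ b c, G.TwoNeighbors W w' b c := by
    rintro w w' ⟨b, c, h⟩ hw' hww'
    obtain ⟨p, hp⟩ := h.exists_of_adj hg hW hmin hw' hww'
    exact ⟨_, _, hp⟩
  have hnotu : ¬ ∃ b c, G.TwoNeighbors W u b c := fun h =>
    hnot (hprop (hprop h hy hyu.symm) hv hvy.symm)
  have huniq : ∀ {w b c}, w ∈ W' → G.Adj w b → G.Adj w c → G.Adj v b → G.Adj v c → b = c :=
    fun hw h1 h2 h3 h4 => hg.no4 h1 h3.symm h4 h2.symm ((memW' _).1 hw).2.1
  have hcase : ∀ {w b}, w ∈ W' → b ∈ W → G.Adj w b → b ∈ W' ∨ G.Adj v b := by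
    intro w b hw hb hwb
    by_cases h : G.Adj v b
    · exact Or.inr h
    · refine Or.inl ((memW' b).2 ⟨hb, ?_, h⟩)
      rintro rfl
      exact ((memW' w).1 hw).2.2 hwb.symm
  rcases ih W' hlt (hW.diff_closedNeighbor hv memW') u huW' with hiso | ⟨w, hw | hw⟩ | ⟨z, hz, hzu⟩
  · exfalso
    obtain ⟨b, hb, hub, hby⟩ := hmin u hu y
    rcases hcase huW' hb hub with h | h
    · exact hiso b h hub
    · exact hby (huniq huW' hub hyu.symm h hvy)
  · exfalso
    refine hnotu ⟨w, y, hu, ((memW' w).1 hw.mem_stem).1, hy, hw.adj, hyu.symm, ?_, ?_⟩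
    · rintro rfl
      exact ((memW' _).1 hw.mem_stem).2.2 hvy
    · intro b hb hub
      rcases hcase huW' hb hub with h | h
      · exact Or.inl (hw.eq_stem b h hub)
      · exact Or.inr (huniq huW' hub hyu.symm h hvy)
  · exfalso
    have hwW := ((memW' w).1 hw.mem).1
    obtain ⟨b, hb, hwb, hbu⟩ := hmin w hwW u
    have hvb := (hcase hw.mem hb hwb).resolve_left fun h => hbu (hw.eq_stem b h hwb)
    refine hnotu (hprop ⟨u, b, hwW, hu, hb, hw.adj, hwb, hbu.symm, ?_⟩ hu hw.adj)
    intro c hc hwc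
    rcases hcase hw.mem hc hwc with h | h
    · exact Or.inl (hw.eq_stem c h hwc)
    · exact Or.inr (huniq hw.mem hwc hwb h hvb)
  · have hzW : ∀ i, z i ∈ W := fun i => ((memW' _).1 (hz.two i).mem).1
    have hone : ∀ i, (∃ b c, G.TwoNeighbors W (z i) b c) ∨
        ∃ b, b ∈ W ∧ G.Adj v b ∧ G.Adj (z i) b := by
      intro i
      by_contra! hno
      refine hno.1 (z (i + 1)) (z (i + 6)) ⟨hzW _, hzW _, hzW _, (hz.two i).adjL, (hz.two i).adjR,
        (hz.two i).ne, fun c hc hzc => ?_⟩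
      rcases hcase (hz.two i).mem hc hzc with h | h
      · exact (hz.two i).eq_or c h hzc
      · exact (hno.2 c hc h hzc).elim
    have a01 : G.Adj (z 0) (z 1) := (hz.two 0).adjL
    have a12 : G.Adj (z 1) (z 2) := (hz.two 1).adjL
    have a23 : G.Adj (z 2) (z 3) := (hz.two 2).adjL
    have n0 : ¬ ∃ b c, G.TwoNeighbors W (z 0) b c := hzu ▸ hnotu
    have n1 := fun h => n0 (hprop h (hzW 0) a01.symm)
    have n2 := fun h => n1 (hprop h (hzW 1) a12.symm)
    have n3 := fun h => n2 (hprop h (hzW 2) a23.symm)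
    obtain ⟨b0, m0, v0, z0⟩ := (hone 0).resolve_left n0
    obtain ⟨b1, m1, v1, z1⟩ := (hone 1).resolve_left n1
    obtain ⟨b2, m2, v2, z2⟩ := (hone 2).resolve_left n2
    obtain ⟨b3, m3, v3, z3⟩ := (hone 3).resolve_left n3
    have h02 : z 0 ≠ z 2 := fun h => absurd (hz.inj h) (by decide)
    have h13 : z 1 ≠ z 3 := fun h => absurd (hz.inj h) (by decide)
    have out : ∀ {b i}, G.Adj v b → b ≠ z i := by
      rintro b i hb rfl
      exact ((memW' _).1 (hz.two i).mem).2.2 hb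
    refine ⟨⟨![b0, b1, b2, b3], ?_, ?_⟩, {z 1, z 6, y}, Finset.card_le_three, ?_⟩
    · have e01 : b0 ≠ b1 := by rintro rfl; exact hg.no3 a01 z1 z0.symm
      have e12 : b1 ≠ b2 := by rintro rfl; exact hg.no3 a12 z2 z1.symm
      have e23 : b2 ≠ b3 := by rintro rfl; exact hg.no3 a23 z3 z2.symm
      have e02 : b0 ≠ b2 := by rintro rfl; exact out v0 (hg.no4 a01 a12 z2 z0.symm h02).symm
      have e13 : b1 ≠ b3 := by rintro rfl; exact out v1 (hg.no4 a12 a23 z3 z1.symm h13).symm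
      have e03 : b0 ≠ b3 := by rintro rfl; exact hg.no5 a01 a12 a23 z3 z0.symm
      rw [← List.nodup_ofFn]
      simp
      grind
    · intro i
      fin_cases i
      exacts [⟨m0, v0⟩, ⟨m1, v1⟩, ⟨m2, v2⟩, ⟨m3, v3⟩]
    · intro c hc huc
      rcases hcase huW' hc huc with h | h
      · rcases (hz.two 0).eq_or c h (hzu ▸ huc) with h | h
        · simp [h]
        · simp [h]
      · simp [huniq huW' huc hyu.symm h hvy]

theorem MinDegTwo.tame {W : Finset V} (hg : NoShortCycle G) (hW : G.GapLE W 0)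
    (hmin : G.MinDegTwo W)
    (ih : ∀ W' : Finset V, W'.card < W.card → G.GapLE W' 0 → ∀ v ∈ W', G.Tame W' v)
    {v : V} (hv : v ∈ W) : G.Tame W v := by
  by_cases hD : ∃ b c, G.TwoNeighbors W v b c
  · obtain ⟨b, c, h⟩ := hD
    exact Or.inr (Or.inr (h.exists_heptagon hg hW hmin))
  exfalso
  obtain ⟨y, hy, hvy, -⟩ := hmin v hv v
  obtain ⟨u, hu, hyu, huv⟩ := hmin y hy v
  have hDu : ¬ ∃ b c, G.TwoNeighbors W u b c := by
    rintro ⟨b, c, h⟩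
    obtain ⟨p, hp⟩ := h.exists_of_adj hg hW hmin hy hyu.symm
    obtain ⟨p', hp'⟩ := hp.exists_of_adj hg hW hmin hv hvy.symm
    exact hD ⟨_, _, hp'⟩
  obtain ⟨-, s, hs, hus⟩ := hmin.exists_four_neighbors hg hW ih hv hy hu hvy hyu huv hD
  obtain ⟨⟨f, hf, hf'⟩, -⟩ :=
    hmin.exists_four_neighbors hg hW ih hu hy hv hyu.symm hvy.symm huv.symm hDu
  have := Finset.card_le_card_of_injOn (s := Finset.univ) (t := s) f
    (fun i _ => hus _ (hf' i).1 (hf' i).2) hf.injOn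
  simp at this
  omega

theorem GapLE.diff_pendant [DecidableEq V] {W : Finset V} {l t : V} (hW : G.GapLE W 0)
    (hl : G.LeafIn W l t) : G.GapLE ((W.erase t).erase l) 0 := by
  intro A B hAW hBW hA hB hdom
  have hsub : ∀ {S : Finset V}, S ⊆ (W.erase t).erase l → ∀ b ∈ S, b ≠ l ∧ b ≠ t ∧ b ∈ W := by
    intro S hS b hb
    simpa using hS hb
  have hind : ∀ {S : Finset V}, S ⊆ (W.erase t).erase l → G.Indep S → G.Indep (S ∪ {l}) := by
    intro S hS hSi a ha b hb hab
    simp only [Finset.mem_union, Finset.mem_singleton] at ha hb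
    rcases ha with ha | rfl <;> rcases hb with hb | rfl
    · exact hSi a ha b hb hab
    · exact (hsub hS a ha).2.1 (hl.eq_stem a (hsub hS a ha).2.2 hab.symm)
    · exact (hsub hS b hb).2.1 (hl.eq_stem b (hsub hS b hb).2.2 hab)
    · exact hab.ne rfl
  have hmono : ∀ {u}, G.DominatedBy A u → G.DominatedBy (A ∪ {l}) u := by
    rintro u (hu | ⟨a, ha, hau⟩)
    · exact Or.inl (Finset.mem_union_left _ hu)
    · exact Or.inr ⟨a, Finset.mem_union_left _ ha, hau⟩
  refine hW.exchange A B {l} ?_ (fun b hb => (hsub hBW b hb).2.2) (hind hAW hA) (hind hBW hB) ?_ ?_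
  · intro b hb
    rcases Finset.mem_union.1 hb with hb | hb
    · exact (hsub hAW b hb).2.2
    · rw [Finset.mem_singleton.1 hb]; exact hl.mem
  · rw [Finset.disjoint_singleton_right]
    exact fun h => (hsub hBW l h).1 rfl
  · intro b hb
    refine ⟨hmono (hdom b hb).1, fun u hu hbu => ?_⟩
    by_cases hut : u = t
    · exact Or.inr ⟨l, by simp, hut ▸ hl.adj⟩
    by_cases hul : u = l
    · exact Or.inl (by simp [hul])
    exact hmono ((hdom b hb).2 u (by simp [hut, hul, hu]) hbu)

theorem LeafIn.tame {W : Finset V} (hg : NoShortCycle G) (hW : G.GapLE W 0)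
    (ih : ∀ W' : Finset V, W'.card < W.card → G.GapLE W' 0 → ∀ v ∈ W', G.Tame W' v)
    {l t : V} (hl : G.LeafIn W l t) {v : V} (hv : v ∈ W) : G.Tame W v := by
  classical
  by_cases hvl : v = l
  · exact Or.inr (Or.inl ⟨t, Or.inl (hvl ▸ hl)⟩)
  by_cases hvt : v = t
  · exact Or.inr (Or.inl ⟨l, Or.inr (hvt ▸ hl)⟩)
  set W₁ := (W.erase t).erase l with hW₁def
  have hW₁ : G.GapLE W₁ 0 := hW.diff_pendant hl
  have mem₁ : ∀ {u}, u ∈ W₁ ↔ u ≠ l ∧ u ≠ t ∧ u ∈ W := by simp [hW₁def]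
  have hlt : W₁.card < W.card := Finset.card_lt_card <| (Finset.ssubset_iff_of_subset
    (fun u hu => (mem₁.1 hu).2.2)).2 ⟨l, hl.mem, fun h => (mem₁.1 h).1 rfl⟩
  have ih₁ := ih W₁ hlt hW₁
  have hcase : ∀ {w b}, w ∈ W₁ → b ∈ W → G.Adj w b → b ∈ W₁ ∨ b = t := by
    intro w b hw hb hwb
    by_cases hbt : b = t
    · exact Or.inr hbt
    refine Or.inl (mem₁.2 ⟨?_, hbt, hb⟩)
    rintro rfl
    exact (mem₁.1 hw).2.1 (hl.eq_stem w (mem₁.1 hw).2.2 hwb.symm)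
  have hl₁ : ∀ {w}, w ∈ W₁ → ¬ G.Adj l w := fun hw h =>
    (mem₁.1 hw).2.1 (hl.eq_stem _ (mem₁.1 hw).2.2 h)
  -- A pendant edge of the smaller graph stays incident with a pendant edge.
  have hpend : ∀ {a w}, G.LeafIn W₁ w a → G.LeafIn W w a ∨ G.LeafIn W a w := by
    intro a w hw
    have hwW := (mem₁.1 hw.mem).2.2
    have haW := (mem₁.1 hw.mem_stem).2.2
    by_cases hwt : G.Adj w t
    swap
    · refine Or.inl ⟨hwW, haW, hw.adj, fun u hu hwu => ?_⟩
      rcases hcase hw.mem hu hwu with h | rfl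
      · exact hw.eq_stem u h hwu
      · exact (hwt hwu).elim
    have hat : ¬ G.Adj a t := fun h => hg.no3 hw.adj h hwt.symm
    refine Or.inr ⟨haW, hwW, hw.adj.symm, fun b hb hab => ?_⟩
    by_contra hbw
    have hb₁ : b ∈ W₁ := (hcase hw.mem_stem hb hab).resolve_right fun h => hat (h ▸ hab)
    have hbt : ¬ G.Adj b t := fun h =>
      (mem₁.1 hw.mem_stem).2.1 (hg.no4 hwt h.symm hab.symm hw.adj.symm (Ne.symm hbw)).symm
    rcases ih₁ b hb₁ with hiso | ⟨c, hc | hc⟩ | ⟨z, hz, hzb⟩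
    · exact hiso a hw.mem_stem hab.symm
    · obtain rfl := hc.eq_stem a hw.mem_stem hab.symm
      exact hbw (hc.unique hg hW₁ hw)
    · have hct : ¬ G.Adj c t := fun h => hg.no5 hwt h.symm hc.adj hab.symm hw.adj.symm
      have hwc : ¬ G.Adj w c := fun h => by
        obtain rfl := hw.eq_stem c hc.mem h
        exact hbw (hc.eq_stem w hw.mem hw.adj.symm).symm
      have hcw : c ≠ w := by
        rintro rfl
        exact hab.ne (hw.eq_stem b hb₁ hc.adj).symm
      have hlc := hl₁ hc.mem
      have hlw := hl₁ hw.mem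
      have hlc' := (mem₁.1 hc.mem).1
      have hlw' := (mem₁.1 hw.mem).1
      have := hW {t, b} {l, w, c}
        (by simp [Finset.insert_subset_iff, hl.mem_stem, hb])
        (by simp [Finset.insert_subset_iff, hl.mem, hwW, (mem₁.1 hc.mem).2.2])
        (by simp [Indep, hbt, G.adj_comm t b])
        (by simp [Indep, hlc, hlw, hwc, G.adj_comm w l, G.adj_comm c l, G.adj_comm c w]) ?_
      · rw [Finset.card_eq_three.2 ⟨l, w, c, hlw'.symm, hlc'.symm, hcw.symm, rfl⟩] at this
        have := this.trans (Nat.add_le_add_right Finset.card_le_two 0)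
        omega
      · have dt : G.DominatedBy {t, b} t := Or.inl (by simp)
        have db : G.DominatedBy {t, b} b := Or.inl (by simp)
        have da : G.DominatedBy {t, b} a := Or.inr ⟨b, by simp, hab.symm⟩
        have dl : G.DominatedBy {t, b} l := Or.inr ⟨t, by simp, hl.adj.symm⟩
        have dw : G.DominatedBy {t, b} w := Or.inr ⟨t, by simp, hwt.symm⟩
        have dc : G.DominatedBy {t, b} c := Or.inr ⟨b, by simp, hc.adj.symm⟩
        intro x hx
        simp only [Finset.mem_insert, Finset.mem_singleton] at hx
        rcases hx with rfl | rfl | rfl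
        · refine ⟨dl, fun u hu hxu => ?_⟩
          rwa [hl.eq_stem u hu hxu]
        · refine ⟨dw, fun u hu hxu => ?_⟩
          rcases hcase hw.mem hu hxu with h | rfl
          · rwa [hw.eq_stem u h hxu]
          · exact dt
        · refine ⟨dc, fun u hu hxu => ?_⟩
          rcases hcase hc.mem hu hxu with h | rfl
          · rwa [hc.eq_stem u h hxu]
          · exact dt
    · obtain ⟨i, rfl⟩ := hz.exists_eq_of_adj (i := 0) hw.mem_stem (hzb ▸ hab.symm)
      obtain ⟨j, rfl⟩ := hz.exists_eq_of_adj hw.mem hw.adj.symm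
      exact hz.not_leafIn hw
  rcases ih₁ v (mem₁.2 ⟨hvl, hvt, hv⟩) with hiso | ⟨w, hw | hw⟩ | ⟨z, hz, hzv⟩
  · by_cases hvt' : G.Adj v t
    · refine Or.inr (Or.inl ⟨t, Or.inl ⟨hv, hl.mem_stem, hvt', fun u hu hvu => ?_⟩⟩)
      exact (hcase (mem₁.2 ⟨hvl, hvt, hv⟩) hu hvu).resolve_left fun h => hiso u h hvu
    · refine Or.inl fun u hu hvu => ?_
      rcases hcase (mem₁.2 ⟨hvl, hvt, hv⟩) hu hvu with h | rfl
      · exact hiso u h hvu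
      · exact hvt' hvu
  · exact Or.inr (Or.inl ⟨w, hpend hw⟩)
  · exact Or.inr (Or.inl ⟨w, (hpend hw).symm⟩)
  · refine Or.inr (Or.inr ⟨z, ⟨hz.inj, fun i => ?_⟩, hzv⟩)
    have hzW : ∀ i, z i ∈ W := fun i => (mem₁.1 (hz.two i).mem).2.2
    refine ⟨hzW _, hzW _, hzW _, (hz.two i).adjL, (hz.two i).adjR, (hz.two i).ne,
      fun u hu hzu => ?_⟩
    rcases hcase (hz.two i).mem hu hzu with h | rfl
    · exact (hz.two i).eq_or u h hzu
    exfalso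
    -- Rotate so that the neighbour of the stem is the vertex with index zero.
    obtain ⟨y, hy, hyu⟩ : ∃ y, G.IsHeptagon W₁ y ∧ G.Adj (y 0) u :=
      ⟨_, hz.rotate i, by simpa using hzu⟩
    have hyW : ∀ i, y i ∈ W := fun i => (mem₁.1 (hy.two i).mem).2.2
    have hadj : ∀ i j, G.Adj (y i) (y j) → j = i + 1 ∨ j = i + 6 := fun i j h =>
      ((hy.two i).eq_or _ (hy.two j).mem h).imp (fun h => hy.inj h) (fun h => hy.inj h)
    have a01 : G.Adj (y 0) (y 1) := (hy.two 0).adjL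
    have a12 : G.Adj (y 1) (y 2) := (hy.two 1).adjL
    have a23 : G.Adj (y 2) (y 3) := (hy.two 2).adjL
    have a34 : G.Adj (y 3) (y 4) := (hy.two 3).adjL
    have a45 : G.Adj (y 4) (y 5) := (hy.two 4).adjL
    have a56 : G.Adj (y 5) (y 6) := (hy.two 5).adjL
    have a60 : G.Adj (y 6) (y 0) := (hy.two 6).adjL
    have hu2 : ¬ G.Adj u (y 2) := fun h =>
      (mem₁.1 (hy.two 1).mem).2.1 (hg.no4 hyu h a12.symm a01.symm
        (fun h => absurd (hy.inj h) (by decide))).symm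
    have hu5 : ¬ G.Adj u (y 5) := fun h =>
      (mem₁.1 (hy.two 6).mem).2.1 (hg.no4 hyu h a56 a60
        (fun h => absurd (hy.inj h) (by decide))).symm
    have h25 : ¬ G.Adj (y 2) (y 5) := fun h => absurd (hadj _ _ h) (by decide)
    have h13 : ¬ G.Adj (y 1) (y 3) := fun h => absurd (hadj _ _ h) (by decide)
    have h15 : ¬ G.Adj (y 1) (y 5) := fun h => absurd (hadj _ _ h) (by decide)
    have h35 : ¬ G.Adj (y 3) (y 5) := fun h => absurd (hadj _ _ h) (by decide)
    have hly : ∀ i, ¬ G.Adj l (y i) := fun i => hl₁ (hy.two i).mem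
    have hly' : ∀ i, ¬ G.Adj (y i) l := fun i h => hly i h.symm
    have hne : ∀ i, l ≠ y i := fun i h => (mem₁.1 (hy.two i).mem).1 h.symm
    have := hW {u, y 2, y 5} {l, y 1, y 3, y 5}
      (by simp [Finset.insert_subset_iff, hl.mem_stem, hyW])
      (by simp [Finset.insert_subset_iff, hl.mem, hyW])
      (by simp [Indep, hu2, hu5, h25, G.adj_comm (y 2) u, G.adj_comm (y 5) u,
        G.adj_comm (y 5) (y 2)])
      (by simp [Indep, hly, hly', h13, h15, h35, G.adj_comm (y 3) (y 1),
        G.adj_comm (y 5) (y 1), G.adj_comm (y 5) (y 3)]) ?_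
    · rw [Finset.card_insert_of_notMem (by simp [hne]),
        Finset.card_insert_of_notMem (by simp [hy.inj.eq_iff]),
        Finset.card_pair (by simp [hy.inj.eq_iff])] at this
      have := this.trans (Nat.add_le_add_right Finset.card_le_three 0)
      omega
    · have du : G.DominatedBy {u, y 2, y 5} u := Or.inl (by simp)
      have dl : G.DominatedBy {u, y 2, y 5} l := Or.inr ⟨u, by simp, hl.adj.symm⟩
      have dy : ∀ i, G.DominatedBy {u, y 2, y 5} (y i) := by
        intro i
        fin_cases i
        · exact Or.inr ⟨u, by simp, hyu.symm⟩
        · exact Or.inr ⟨y 2, by simp, a12.symm⟩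
        · exact Or.inl (by simp)
        · exact Or.inr ⟨y 2, by simp, a23⟩
        · exact Or.inr ⟨y 5, by simp, a45.symm⟩
        · exact Or.inl (by simp)
        · exact Or.inr ⟨y 5, by simp, a56⟩
      have dyN : ∀ i, ∀ w ∈ W, G.Adj (y i) w → G.DominatedBy {u, y 2, y 5} w := by
        intro i w hw hyw
        rcases hcase (hy.two i).mem hw hyw with h | rfl
        · rcases (hy.two i).eq_or w h hyw with rfl | rfl <;> exact dy _
        · exact du
      intro x hx
      simp only [Finset.mem_insert, Finset.mem_singleton] at hx
      rcases hx with rfl | rfl | rfl | rfl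
      · refine ⟨dl, fun w hw hxw => ?_⟩
        rwa [hl.eq_stem w hw hxw]
      all_goals exact ⟨dy _, dyN _⟩

/-- Structure of well-covered graphs without cycles of length at most five. -/
theorem GapLE.tame {W : Finset V} (hg : NoShortCycle G) (hW : G.GapLE W 0) {v : V}
    (hv : v ∈ W) : G.Tame W v := by
  classical
  suffices H : ∀ n, ∀ W : Finset V, W.card = n → G.GapLE W 0 → ∀ v ∈ W, G.Tame W v from
    H _ W rfl hW v hv
  intro n
  induction n using Nat.strong_induction_on with
  | _ n ihn =>
    rintro W rfl hW v hv
    have ih : ∀ W' : Finset V, W'.card < W.card → G.GapLE W' 0 → ∀ v ∈ W', G.Tame W' v :=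
      fun W' h => ihn _ h W' rfl
    by_cases hleaf : ∃ l t, G.LeafIn W l t
    · obtain ⟨l, t, hl⟩ := hleaf
      exact hl.tame hg hW ih hv
    by_cases hiso : ∃ u ∈ W, ∀ w ∈ W, ¬ G.Adj u w
    · obtain ⟨u, hu, hiso⟩ := hiso
      by_cases hvu : v = u
      · exact Or.inl (hvu ▸ hiso)
      have hmem : ∀ w, w ∈ W.erase u ↔ w ∈ W ∧ w ≠ u ∧ ¬ G.Adj u w := by
        intro w
        rw [Finset.mem_erase]
        exact ⟨fun h => ⟨h.2, h.1, hiso w h.2⟩, fun h => ⟨h.2.1, h.1⟩⟩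
      have hcase : ∀ {w b}, w ∈ W.erase u → b ∈ W → G.Adj w b → b ∈ W.erase u := by
        intro w b hw hb hwb
        refine Finset.mem_erase.2 ⟨?_, hb⟩
        rintro rfl
        exact hiso w (Finset.mem_of_mem_erase hw) hwb.symm
      have hup : ∀ {a b}, G.LeafIn (W.erase u) a b → G.LeafIn W a b := fun h =>
        ⟨Finset.mem_of_mem_erase h.mem, Finset.mem_of_mem_erase h.mem_stem, h.adj,
          fun w hw haw => h.eq_stem w (hcase h.mem hw haw) haw⟩
      have hvW : v ∈ W.erase u := Finset.mem_erase.2 ⟨hvu, hv⟩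
      rcases ih _ (Finset.card_erase_lt_of_mem hu) (hW.diff_closedNeighbor hu hmem) v hvW with
        h | ⟨w, h⟩ | ⟨z, hz, hzv⟩
      · exact Or.inl fun w hw hvw => h w (hcase hvW hw hvw) hvw
      · exact Or.inr (Or.inl ⟨w, h.imp hup hup⟩)
      · refine Or.inr (Or.inr ⟨z, ⟨hz.inj, fun i => ?_⟩, hzv⟩)
        have h := hz.two i
        exact ⟨Finset.mem_of_mem_erase h.mem, Finset.mem_of_mem_erase h.memL,
          Finset.mem_of_mem_erase h.memR, h.adjL, h.adjR, h.ne,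
          fun w hw hzw => h.eq_or w (hcase h.mem hw hzw) hzw⟩
    · refine MinDegTwo.tame hg hW (fun w hw u => ?_) ih hv
      by_contra! hno
      push Not at hiso hleaf
      obtain ⟨b, hb, hwb⟩ := hiso w hw
      exact hleaf w b ⟨hw, hb, hwb, fun c hc hwc => (hno c hc hwc).trans (hno b hb hwb).symm⟩

theorem _root_.AlmostWellCovered.gapLE [Fintype V] (h : AlmostWellCovered G) :
    G.GapLE Finset.univ 1 := by
  classical
  intro A B _ _ hA hB hdom
  obtain ⟨M, hAM, hM⟩ := (Set.toFinite {S : Finset V | G.Indep S}).exists_le_maximal hA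
  have hAM : A ⊆ M := hAM
  have hMi : G.Indep M := hM.prop
  have hmax : MaxIndepSet G (M : Set V) := by
    refine ⟨fun a ha b hb => hMi a ha b hb, fun t ht hMt => ?_⟩
    have h1 : G.Indep t.toFinset := fun a ha b hb =>
      ht (Set.mem_toFinset.1 ha) (Set.mem_toFinset.1 hb)
    have h2 : M ⊆ t.toFinset := fun a ha => Set.mem_toFinset.2 (hMt ha)
    exact hMt.antisymm fun a ha => hM.le_of_ge h1 h2 (Set.mem_toFinset.2 ha)
  have hi : iNum G ≤ M.card := Nat.sInf_le ⟨M, hmax, Set.ncard_coe_finset M⟩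
  have hα : (B ∪ (M \ A)).card ≤ alphaNum G := by
    refine le_csSup ⟨Fintype.card V, ?_⟩ ⟨((B ∪ (M \ A) : Finset V) : Set V), ?_,
      Set.ncard_coe_finset _⟩
    · rintro n ⟨s, -, rfl⟩
      rw [Set.ncard_eq_toFinset_card']
      exact Finset.card_le_univ _
    · have hBM : ∀ b ∈ B, ∀ c ∈ M \ A, ¬ G.Adj b c := by
        intro b hb c hc hbc
        rw [Finset.mem_sdiff] at hc
        rcases (hdom b hb).2 c (Finset.mem_univ _) hbc with h | ⟨a, ha, hac⟩
        · exact hc.2 h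
        · exact hMi a (hAM ha) c hc.1 hac
      intro b hb c hc hbc
      rw [Finset.mem_coe, Finset.mem_union] at hb hc
      rcases hb with hb | hb <;> rcases hc with hc | hc
      · exact hB b hb c hc hbc
      · exact hBM b hb c hc hbc
      · exact hBM c hc b hb hbc.symm
      · exact hMi b (Finset.mem_sdiff.1 hb).1 c (Finset.mem_sdiff.1 hc).1 hbc
  have hdisj : Disjoint B (M \ A) := by
    rw [Finset.disjoint_left]
    intro b hb hbM
    rw [Finset.mem_sdiff] at hbM
    rcases (hdom b hb).1 with h | ⟨a, ha, hab⟩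
    · exact hbM.2 h
    · exact hMi a (hAM ha) b hbM.1 hab
  rw [Finset.card_union_of_disjoint hdisj, Finset.card_sdiff_of_subset hAM] at hα
  have := Finset.card_le_card hAM
  simp only [AlmostWellCovered, indepGap] at h
  omega

/-- A component of an induced subgraph is isomorphic to `H` as soon as it contains a closed
induced copy of the connected graph `H`. -/
theorem nonempty_component_iso {ι : Type*} {H : SimpleGraph ι} (hH : H.Preconnected) {S : Set V}
    (f : ι → V) (hf : Function.Injective f) (hS : ∀ i, f i ∈ S)
    (hadj : ∀ i j, G.Adj (f i) (f j) ↔ H.Adj i j)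
    (hclosed : ∀ i, ∀ u ∈ S, G.Adj (f i) u → u ∈ Set.range f) {u : S}
    (hu : (u : V) ∈ Set.range f) :
    Nonempty ((G.induce S).induce ((G.induce S).connectedComponentMk u).supp ≃g H) := by
  obtain ⟨i₀, hi₀⟩ := hu
  obtain rfl : ⟨f i₀, hS i₀⟩ = u := Subtype.ext hi₀
  set c := (G.induce S).connectedComponentMk ⟨f i₀, hS i₀⟩
  let φ : H →g G.induce S := ⟨fun i => ⟨f i, hS i⟩, fun h => (hadj _ _).2 h⟩
  have hmem : ∀ i, (⟨f i, hS i⟩ : S) ∈ c.supp := fun i =>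
    ConnectedComponent.sound ((hH i i₀).map φ)
  have hrange : ∀ u v : S, (G.induce S).Reachable u v → (u : V) ∈ Set.range f →
      (v : V) ∈ Set.range f := by
    rintro u v ⟨p⟩
    induction p with
    | nil => exact id
    | cons h _ ih =>
      rintro ⟨i, hi⟩
      exact ih (hclosed i _ (Subtype.prop _) (hi ▸ h))
  let e : ι ≃ c.supp := Equiv.ofBijective (fun i => ⟨⟨f i, hS i⟩, hmem i⟩)
    ⟨fun i j h => hf (congrArg Subtype.val (congrArg Subtype.val h)), by
      rintro ⟨u, hu⟩
      obtain ⟨i, hi⟩ := hrange _ _ (ConnectedComponent.exact hu).symm ⟨i₀, rfl⟩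
      exact ⟨i, Subtype.ext (Subtype.ext hi)⟩⟩
  exact ⟨(⟨e, hadj _ _⟩ : H ≃g (G.induce S).induce c.supp).symm⟩

theorem nonempty_component_iso_two {S : Set V} {a b : V} (ha : a ∈ S) (hb : b ∈ S)
    (hab : G.Adj a b) (hNa : ∀ u ∈ S, G.Adj a u → u = b) (hNb : ∀ u ∈ S, G.Adj b u → u = a)
    {u : S} (hu : (u : V) = a ∨ (u : V) = b) :
    Nonempty ((G.induce S).induce ((G.induce S).connectedComponentMk u).supp ≃g
      (⊤ : SimpleGraph (Fin 2))) := by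
  refine nonempty_component_iso preconnected_top ![a, b] ?_ ?_ ?_ ?_ ?_
  · intro i j hij
    have := hab.ne
    fin_cases i <;> fin_cases j <;> simp_all
  · intro i
    fin_cases i
    exacts [ha, hb]
  · intro i j
    fin_cases i <;> fin_cases j <;> simp [hab, hab.symm]
  · intro i u hu hiu
    fin_cases i
    exacts [⟨1, (hNa u hu hiu).symm⟩, ⟨0, (hNb u hu hiu).symm⟩]
  · rcases hu with hu | hu
    exacts [⟨0, hu.symm⟩, ⟨1, hu.symm⟩]

theorem nonempty_component_iso_four {S : Set V} (hg : NoShortCycle G) {a b c d : V} (ha : a ∈ S)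
    (hb : b ∈ S) (hc : c ∈ S) (hd : d ∈ S) (hab : G.Adj a b) (hbc : G.Adj b c) (hcd : G.Adj c d)
    (hca : c ≠ a) (hdb : d ≠ b) (hNa : ∀ u ∈ S, G.Adj a u → u = b)
    (hNb : ∀ u ∈ S, G.Adj b u → u = a ∨ u = c) (hNc : ∀ u ∈ S, G.Adj c u → u = d ∨ u = b)
    (hNd : ∀ u ∈ S, G.Adj d u → u = c) {u : S} (hu : (u : V) = b ∨ (u : V) = a) :
    Nonempty ((G.induce S).induce ((G.induce S).connectedComponentMk u).supp ≃g
      pathGraph 4) := by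
  have nac : ¬ G.Adj a c := fun h => hbc.ne (hNa c hc h).symm
  have nad : ¬ G.Adj a d := fun h => hdb (hNa d hd h)
  have nbd : ¬ G.Adj b d := fun h => hg.no3 hbc hcd h.symm
  have hda : d ≠ a := by
    rintro rfl
    exact nac hcd.symm
  refine nonempty_component_iso (pathGraph_preconnected 4) ![a, b, c, d] ?_ ?_ ?_ ?_ ?_
  · intro i j hij
    have := hab.ne
    have := hbc.ne
    have := hcd.ne
    fin_cases i <;> fin_cases j <;> simp_all
  · intro i
    fin_cases i
    exacts [ha, hb, hc, hd]
  · intro i j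
    rw [pathGraph_adj]
    fin_cases i <;> fin_cases j <;>
      simp [hab, hbc, hcd, hab.symm, hbc.symm, hcd.symm, nac, nad, nbd, G.adj_comm c a,
        G.adj_comm d a, G.adj_comm d b]
  · intro i u hu hiu
    fin_cases i
    · exact ⟨1, (hNa u hu hiu).symm⟩
    · rcases hNb u hu hiu with h | h
      exacts [⟨0, h.symm⟩, ⟨2, h.symm⟩]
    · rcases hNc u hu hiu with h | h
      exacts [⟨3, h.symm⟩, ⟨1, h.symm⟩]
    · exact ⟨2, (hNd u hu hiu).symm⟩
  · rcases hu with hu | hu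
    exacts [⟨1, hu.symm⟩, ⟨0, hu.symm⟩]

theorem mem_completeU_of_adj {u v : V} (hu : u ∈ completeU G) (huv : G.Adj u v) :
    v ∈ completeU G := by
  have : G.connectedComponentMk v = G.connectedComponentMk u :=
    ConnectedComponent.sound huv.symm.reachable
  simpa only [completeU, Set.mem_ofPred_eq, this] using hu

theorem adj_of_mem_completeU {u v w : V} (hu : u ∈ completeU G) (huv : G.Adj u v)
    (huw : G.Adj u w) (hvw : v ≠ w) : G.Adj v w :=
  hu (ConnectedComponent.sound huv.symm.reachable) (ConnectedComponent.sound huw.symm.reachable)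
    hvw

theorem exists_adj_of_notMem_completeU {v : V} (hv : v ∉ completeU G) : ∃ u, G.Adj v u := by
  by_contra! hno
  refine hv ?_
  have key : ∀ a, a ∈ (G.connectedComponentMk v).supp → a = v := by
    intro a ha
    obtain ⟨p⟩ := (ConnectedComponent.exact ha).symm
    cases p with
    | nil => rfl
    | cons h _ => exact (hno _ h).elim
  intro a ha b hb hab
  exact (hab ((key a ha).trans (key b hb).symm)).elim

theorem isLeaf_iff [Fintype V] {v : V} :
    IsLeaf G v ↔ v ∉ completeU G ∧ ∃ t, G.LeafIn Finset.univ v t := by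
  refine and_congr_right fun hv => ?_
  have hset : {u | u ∉ completeU G ∧ G.Adj v u} = {u | G.Adj v u} := by
    ext u
    exact ⟨And.right, fun h => ⟨fun hu => hv (mem_completeU_of_adj hu h.symm), h⟩⟩
  rw [hset, Set.ncard_eq_one]
  refine exists_congr fun t => ⟨fun h => ?_, fun h => ?_⟩
  · have ht : G.Adj v t := h.symm.subset (Set.mem_singleton t)
    exact ⟨Finset.mem_univ _, Finset.mem_univ _, ht, fun u _ hu => h.subset hu⟩
  · ext u
    exact ⟨fun hu => h.eq_stem u (Finset.mem_univ _) hu, fun hu => hu ▸ h.adj⟩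

/-- `v` and all its neighbours have degree at least two. -/
def IsCore (G : SimpleGraph V) (v : V) : Prop :=
  (∀ a, ∃ b, b ≠ a ∧ G.Adj v b) ∧ ∀ u, G.Adj v u → ∃ w, w ≠ v ∧ G.Adj u w

theorem IsCore.not_adj_leaf [Fintype V] {v l t : V} (hv : G.IsCore v)
    (hl : G.LeafIn Finset.univ l t) : ¬ G.Adj v l := fun h => by
  obtain ⟨w, hwv, hlw⟩ := hv.2 l h
  exact hwv ((hl.eq_stem w (Finset.mem_univ _) hlw).trans
    (hl.eq_stem v (Finset.mem_univ _) h.symm).symm)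

theorem IsCore.exists_leafIn_of_adj [Fintype V] {v u : V} (hv : G.IsCore v) (hvu : G.Adj v u)
    (hu : ¬ G.IsCore u) : ∃ l, G.LeafIn Finset.univ l u := by
  by_contra! hno
  obtain ⟨w, hwv, huw⟩ := hv.2 u hvu
  refine hu ⟨fun a => ?_, fun l hul => ?_⟩
  · by_cases ha : v = a
    · exact ⟨w, ha ▸ hwv, huw⟩
    · exact ⟨v, ha, hvu.symm⟩
  · by_contra! hl
    exact hno l ⟨Finset.mem_univ _, Finset.mem_univ _, hul.symm,
      fun b _ hb => by_contra fun h => hl b h hb⟩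

theorem IsCore.notMem_completeU (hg : NoShortCycle G) {v : V} (hv : G.IsCore v) :
    v ∉ completeU G := by
  intro hU
  obtain ⟨a, -, ha⟩ := hv.1 v
  obtain ⟨b, hba, hb⟩ := hv.1 a
  exact hg.no3 hb (adj_of_mem_completeU hU hb ha hba) ha.symm

theorem mem_typeSet_zero_iff [Fintype V] (hg : NoShortCycle G) {v : V} :
    v ∈ typeSet G 0 ↔ v ∈ completeU G ∨ G.IsCore v := by
  constructor
  · rintro (⟨⟨hU, hleaf⟩, hcard⟩ | ⟨hU, -⟩)
    · refine Or.inr ⟨fun a => ?_, fun u hvu => ?_⟩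
      · by_contra! hno
        obtain ⟨u, hu⟩ := exists_adj_of_notMem_completeU hU
        refine hleaf (isLeaf_iff.2 ⟨hU, u, Finset.mem_univ _, Finset.mem_univ _, hu,
          fun w _ hw => ?_⟩)
        by_contra hwu
        by_cases hwa : w = a
        · exact hno u (fun h => hwu (hwa.trans h.symm)) hu
        · exact hno w hwa hw
      · by_contra! hno
        rw [Set.ncard_eq_zero] at hcard
        have : IsLeaf G u := isLeaf_iff.2
          ⟨fun h => hU (mem_completeU_of_adj h hvu.symm), v, Finset.mem_univ _,
            Finset.mem_univ _, hvu.symm, fun w _ hw => by_contra fun h => hno w h hw⟩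
        exact hcard.subset ⟨this, hvu⟩
    · exact Or.inl hU
  · rintro (hU | hv)
    · exact Or.inr ⟨hU, rfl⟩
    · refine Or.inl ⟨⟨hv.notMem_completeU hg, fun hl => ?_⟩, ?_⟩
      · obtain ⟨-, t, ht⟩ := isLeaf_iff.1 hl
        obtain ⟨b, hbt, hb⟩ := hv.1 t
        exact hbt (ht.eq_stem b (Finset.mem_univ _) hb)
      · rw [Set.ncard_eq_zero, Set.eq_empty_iff_forall_notMem]
        rintro u ⟨hl, hvu⟩
        obtain ⟨-, t, ht⟩ := isLeaf_iff.1 hl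
        obtain ⟨w, hwv, huw⟩ := hv.2 u hvu
        exact hwv ((ht.eq_stem w (Finset.mem_univ _) huw).trans
          (ht.eq_stem v (Finset.mem_univ _) hvu.symm).symm)

theorem exists_leaves_of_hasType_two [Fintype V] {x : V} (hx : HasType G x 2) :
    ∃ l₁ l₂, l₁ ≠ l₂ ∧ G.LeafIn Finset.univ l₁ x ∧ G.LeafIn Finset.univ l₂ x := by
  rcases hx with ⟨-, hcard⟩ | ⟨-, h⟩
  · obtain ⟨l₁, l₂, hne, hset⟩ := Set.ncard_eq_two.1 hcard
    have key : ∀ l ∈ ({l₁, l₂} : Set V), G.LeafIn Finset.univ l x := by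
      intro l hl
      obtain ⟨hleaf, hxl⟩ := hset.symm.subset hl
      obtain ⟨-, t, ht⟩ := isLeaf_iff.1 hleaf
      rwa [ht.eq_stem x (Finset.mem_univ _) hxl.symm]
    exact ⟨l₁, l₂, hne, key _ (by simp), key _ (by simp)⟩
  · omega

/-- The vertex `x` is the stem of two leaves in a graph with independence gap at most one and
without short cycles, and `W` is the complement of its closed neighbourhood. -/
structure DoubleStem [Fintype V] (G : SimpleGraph V) (x l₁ l₂ : V) (W : Finset V) : Prop where
  noShort : NoShortCycle G
  gap : G.GapLE Finset.univ 1
  ne : l₁ ≠ l₂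
  leaf₁ : G.LeafIn Finset.univ l₁ x
  leaf₂ : G.LeafIn Finset.univ l₂ x
  mem_iff : ∀ u, u ∈ W ↔ u ≠ x ∧ ¬ G.Adj x u

/-- `w` is a core vertex whose unique neighbour outside the closed neighbourhood of the double
stem is the core vertex `a`. -/
structure CorePair (G : SimpleGraph V) (W : Finset V) (a w : V) : Prop where
  core_stem : G.IsCore a
  core_leaf : G.IsCore w
  leaf : G.LeafIn W w a

theorem CorePair.leaf_ne_stem {W : Finset V} {a b w w' : V} (hp : G.CorePair W a w)
    (hp' : G.CorePair W b w') (hbw : b ≠ w) : w' ≠ a := by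
  rintro rfl
  exact hbw (hp'.leaf.eq_stem w hp.leaf.mem hp.leaf.adj.symm).symm

section DoubleStem

variable [Fintype V] {x l₁ l₂ : V} {W : Finset V}

theorem DoubleStem.not_adj_core (h : G.DoubleStem x l₁ l₂ W) {y : V} (hy : G.IsCore y) :
    ¬ G.Adj x y := by
  classical
  intro hxy
  have hg := h.noShort
  have key : ∀ n, ∃ m, G.Adj y n → m ≠ y ∧ G.Adj n m := by
    intro n
    by_cases hn : G.Adj y n
    · obtain ⟨m, hm⟩ := hy.2 n hn
      exact ⟨m, fun _ => hm⟩
    · exact ⟨y, fun h => (hn h).elim⟩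
  choose m hm using key
  set N := Finset.univ.filter fun n => G.Adj y n ∧ n ≠ x with hN
  have memN : ∀ {n}, n ∈ N ↔ G.Adj y n ∧ n ≠ x := by simp [hN]
  have hR : G.Indep (N.image m) := by
    intro b hb c hc hbc
    obtain ⟨n, hn, rfl⟩ := Finset.mem_image.1 hb
    obtain ⟨n', hn', rfl⟩ := Finset.mem_image.1 hc
    exact hg.no5 (memN.1 hn).1 (hm n (memN.1 hn).1).2 hbc (hm n' (memN.1 hn').1).2.symm
      (memN.1 hn').1.symm
  have hxR : ∀ b ∈ N.image m, ¬ G.Adj x b ∧ b ≠ x ∧ b ≠ y ∧ ¬ G.Adj y b := by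
    intro b hb
    obtain ⟨n, hn, rfl⟩ := Finset.mem_image.1 hb
    obtain ⟨hyn, hnx⟩ := memN.1 hn
    obtain ⟨hmy, hnm⟩ := hm n hyn
    exact ⟨fun hxm => hnx (hg.no4 hyn hnm hxm.symm hxy hmy.symm),
      fun hmx => hg.no3 hyn (hmx ▸ hnm) hxy, hmy, fun hym => hg.no3 hyn hnm hym.symm⟩
  have hleaf : ∀ {l}, G.LeafIn Finset.univ l x → (∀ b ∈ N.image m, ¬ G.Adj l b) ∧
      ¬ G.Adj l y ∧ l ≠ y ∧ l ∉ N.image m := by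
    intro l hl
    refine ⟨fun b hb hlb => (hxR b hb).2.1 (hl.eq_stem b (Finset.mem_univ _) hlb),
      fun hly => hxy.ne (hl.eq_stem y (Finset.mem_univ _) hly).symm, ?_, ?_⟩
    · rintro rfl
      obtain ⟨b, hbx, hb⟩ := hy.1 x
      exact hbx (hl.eq_stem b (Finset.mem_univ _) hb)
    · intro hlm
      exact (hxR l hlm).1 hl.adj.symm
  obtain ⟨p1, p2, p3, p4⟩ := hleaf h.leaf₁
  obtain ⟨q1, q2, q3, q4⟩ := hleaf h.leaf₂
  have h12 : ¬ G.Adj l₁ l₂ := fun hl => hg.no3 hl h.leaf₂.adj h.leaf₁.adj.symm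
  have hcard := h.gap.exchange {x} {l₁, l₂, y} (N.image m) (Finset.subset_univ _)
    (Finset.subset_univ _) ?_ ?_ ?_ ?_
  · rw [Finset.card_eq_three.2 ⟨l₁, l₂, y, h.ne, p3, q3, rfl⟩, Finset.card_singleton] at hcard
    omega
  · intro b hb c hc hbc
    rw [Finset.mem_union, Finset.mem_singleton] at hb hc
    rcases hb with rfl | hb <;> rcases hc with rfl | hc
    · exact hbc.ne rfl
    · exact (hxR c hc).1 hbc
    · exact (hxR b hb).1 hbc.symm
    · exact hR b hb c hc hbc
  · have hI : G.Indep {l₁, l₂, y} := by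
      simp [Indep, h12, p2, q2, G.adj_comm l₂ l₁, G.adj_comm y l₁, G.adj_comm y l₂]
    have hIR : ∀ b ∈ ({l₁, l₂, y} : Finset V), ∀ c ∈ N.image m, ¬ G.Adj b c := by
      intro b hb c hc
      simp only [Finset.mem_insert, Finset.mem_singleton] at hb
      rcases hb with rfl | rfl | rfl
      exacts [p1 c hc, q1 c hc, (hxR c hc).2.2.2]
    intro b hb c hc hbc
    rw [Finset.mem_union] at hb hc
    rcases hb with hb | hb <;> rcases hc with hc | hc
    · exact hI b hb c hc hbc
    · exact hIR b hb c hc hbc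
    · exact hIR c hc b hb hbc.symm
    · exact hR b hb c hc hbc
  · rw [Finset.disjoint_left]
    intro b hb hbR
    simp only [Finset.mem_insert, Finset.mem_singleton] at hb
    rcases hb with rfl | rfl | rfl
    exacts [p4 hbR, q4 hbR, (hxR _ hbR).2.2.1 rfl]
  · have hx : x ∈ ({x} : Finset V) ∪ N.image m := by simp
    intro b hb
    simp only [Finset.mem_insert, Finset.mem_singleton] at hb
    rcases hb with rfl | rfl | rfl
    · exact ⟨Or.inr ⟨x, hx, h.leaf₁.adj.symm⟩, fun u hu hbu =>
        Or.inl (by rw [h.leaf₁.eq_stem u hu hbu]; exact hx)⟩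
    · exact ⟨Or.inr ⟨x, hx, h.leaf₂.adj.symm⟩, fun u hu hbu =>
        Or.inl (by rw [h.leaf₂.eq_stem u hu hbu]; exact hx)⟩
    · refine ⟨Or.inr ⟨x, hx, hxy⟩, fun u _ hbu => ?_⟩
      by_cases hux : u = x
      · exact Or.inl (hux ▸ hx)
      · exact Or.inr ⟨m u, Finset.mem_union_right _
          (Finset.mem_image_of_mem m (memN.2 ⟨hbu, hux⟩)), (hm u hbu).2.symm⟩

theorem DoubleStem.gapLE (h : G.DoubleStem x l₁ l₂ W) : G.GapLE W 0 := by
  classical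
  intro A B hAW hBW hA hB hdom
  have hl : ∀ {l}, G.LeafIn Finset.univ l x → ∀ b ∈ B, ¬ G.Adj l b ∧ l ≠ b := by
    intro l hl b hb
    have hbW := (h.mem_iff b).1 (hBW hb)
    exact ⟨fun hlb => hbW.1 (hl.eq_stem b (Finset.mem_univ _) hlb),
      fun hlb => hbW.2 (hlb ▸ hl.adj.symm)⟩
  have h12 : ¬ G.Adj l₁ l₂ := fun hl => h.noShort.no3 hl h.leaf₂.adj h.leaf₁.adj.symm
  have n1 : l₁ ∉ insert l₂ B := by
    simpa [h.ne] using fun hB => (hl h.leaf₁ _ hB).2 rfl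
  have n2 : l₂ ∉ B := fun hB => (hl h.leaf₂ _ hB).2 rfl
  have hcard := h.gap (insert x A) (insert l₁ (insert l₂ B)) (Finset.subset_univ _)
    (Finset.subset_univ _) ?_ ?_ ?_
  · rw [Finset.card_insert_of_notMem n1, Finset.card_insert_of_notMem n2] at hcard
    have := Finset.card_insert_le x A
    omega
  · intro b hb c hc hbc
    rw [Finset.mem_insert] at hb hc
    rcases hb with rfl | hb <;> rcases hc with rfl | hc
    · exact hbc.ne rfl
    · exact ((h.mem_iff c).1 (hAW hc)).2 hbc
    · exact ((h.mem_iff b).1 (hAW hb)).2 hbc.symm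
    · exact hA b hb c hc hbc
  · intro b hb c hc hbc
    rw [Finset.mem_insert, Finset.mem_insert] at hb hc
    rcases hb with rfl | rfl | hb <;> rcases hc with rfl | rfl | hc
    · exact hbc.ne rfl
    · exact h12 hbc
    · exact (hl h.leaf₁ c hc).1 hbc
    · exact h12 hbc.symm
    · exact hbc.ne rfl
    · exact (hl h.leaf₂ c hc).1 hbc
    · exact (hl h.leaf₁ b hb).1 hbc.symm
    · exact (hl h.leaf₂ b hb).1 hbc.symm
    · exact hB b hb c hc hbc
  · have hx : x ∈ insert x A := Finset.mem_insert_self _ _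
    have hmono : ∀ {u}, G.DominatedBy A u → G.DominatedBy (insert x A) u := by
      rintro u (hu | ⟨a, ha, hau⟩)
      · exact Or.inl (Finset.mem_insert_of_mem hu)
      · exact Or.inr ⟨a, Finset.mem_insert_of_mem ha, hau⟩
    intro b hb
    rw [Finset.mem_insert, Finset.mem_insert] at hb
    rcases hb with rfl | rfl | hb
    · exact ⟨Or.inr ⟨x, hx, h.leaf₁.adj.symm⟩, fun u hu hbu =>
        Or.inl (by rw [h.leaf₁.eq_stem u hu hbu]; exact hx)⟩
    · exact ⟨Or.inr ⟨x, hx, h.leaf₂.adj.symm⟩, fun u hu hbu =>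
        Or.inl (by rw [h.leaf₂.eq_stem u hu hbu]; exact hx)⟩
    · refine ⟨hmono (hdom b hb).1, fun u _ hbu => ?_⟩
      by_cases hxu : G.Adj x u
      · exact Or.inr ⟨x, hx, hxu⟩
      by_cases hux : u = x
      · exact Or.inl (hux ▸ hx)
      exact hmono ((hdom b hb).2 u ((h.mem_iff u).2 ⟨hux, hxu⟩) hbu)

theorem DoubleStem.mem_of_core (h : G.DoubleStem x l₁ l₂ W) {v : V} (hv : G.IsCore v) :
    v ∈ W := by
  refine (h.mem_iff v).2 ⟨?_, h.not_adj_core hv⟩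
  rintro rfl
  exact hv.not_adj_leaf h.leaf₁ h.leaf₁.adj.symm

theorem DoubleStem.mem_or_adj (h : G.DoubleStem x l₁ l₂ W) {w b : V} (hw : w ∈ W)
    (hwb : G.Adj w b) : b ∈ W ∨ G.Adj x b := by
  by_cases hb : G.Adj x b
  · exact Or.inr hb
  · refine Or.inl ((h.mem_iff b).2 ⟨?_, hb⟩)
    rintro rfl
    exact ((h.mem_iff w).1 hw).2 hwb.symm

theorem DoubleStem.eq_of_adj (h : G.DoubleStem x l₁ l₂ W) {w b c : V} (hw : w ∈ W)
    (hwb : G.Adj w b) (hwc : G.Adj w c) (hb : G.Adj x b) (hc : G.Adj x c) : b = c :=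
  h.noShort.no4 hwb hb.symm hc hwc.symm ((h.mem_iff w).1 hw).1

theorem DoubleStem.core_cases (h : G.DoubleStem x l₁ l₂ W) {v : V} (hv : G.IsCore v) :
    (∃ z, G.IsHeptagon W z ∧ z 0 = v) ∨
      ∃ a w, G.CorePair W a w ∧ (v = a ∨ v = w) := by
  have hvW := h.mem_of_core hv
  have hcore_leaf : ∀ {w a}, G.LeafIn W w a → (∀ b, ∃ c, c ≠ b ∧ G.Adj w c) →
      (∀ b, ∃ c, c ≠ b ∧ G.Adj a c) → G.IsCore w := by
    intro w a hw hw2 ha2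
    refine ⟨hw2, fun u hwu => ?_⟩
    rcases h.mem_or_adj hw.mem hwu with hu | hu
    · rw [hw.eq_stem u hu hwu]; exact ha2 w
    · refine ⟨x, ?_, hu.symm⟩
      rintro rfl
      exact ((h.mem_iff _).1 hw.mem).1 rfl
  rcases h.gapLE.tame h.noShort hvW with hiso | ⟨w, hw | hw⟩ | hz
  · exfalso
    obtain ⟨a, -, ha⟩ := hv.1 v
    obtain ⟨b, hba, hb⟩ := hv.1 a
    have key : ∀ {u}, G.Adj v u → G.Adj x u := fun hu =>
      (h.mem_or_adj hvW hu).resolve_left fun hW => hiso _ hW hu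
    exact hba (h.eq_of_adj hvW hb ha (key hb) (key ha))
  · refine Or.inr ⟨w, v, ⟨?_, hv, hw⟩, Or.inr rfl⟩
    by_contra hwcore
    obtain ⟨l, hl⟩ := hv.exists_leafIn_of_adj hw.adj hwcore
    have hlW : l ∈ W := by
      rcases h.mem_or_adj hw.mem_stem hl.adj.symm with hl' | hl'
      · exact hl'
      · exact (((h.mem_iff w).1 hw.mem_stem).1
          (hl.eq_stem x (Finset.mem_univ _) hl'.symm).symm).elim
    have hl' : G.LeafIn W l w :=
      ⟨hlW, hw.mem_stem, hl.adj, fun u _ hu => hl.eq_stem u (Finset.mem_univ _) hu⟩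
    obtain rfl := hw.unique h.noShort h.gapLE hl'
    exact hwcore (by
      obtain ⟨b, hb, hb'⟩ := hv.1 w
      exact (hb (hl.eq_stem b (Finset.mem_univ _) hb')).elim)
  · refine Or.inr ⟨v, w, ⟨hv, hcore_leaf hw (fun b => ?_) hv.1, hw⟩, Or.inl rfl⟩
    obtain ⟨c, hcv, hwc⟩ := hv.2 w hw.adj.symm
    by_cases hb : b = v
    · exact ⟨c, hb ▸ hcv, hwc⟩
    · exact ⟨v, Ne.symm hb, hw.adj⟩
  · exact Or.inl hz

theorem DoubleStem.core_of_heptagon (h : G.DoubleStem x l₁ l₂ W) {z : Fin 7 → V}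
    (hz : G.IsHeptagon W z) (i : Fin 7) : G.IsCore (z i) := by
  have htwo : ∀ i a, ∃ b, b ≠ a ∧ G.Adj (z i) b := by
    intro i a
    by_cases ha : z (i + 1) = a
    · exact ⟨_, ha ▸ (hz.two i).ne.symm, (hz.two i).adjR⟩
    · exact ⟨_, ha, (hz.two i).adjL⟩
  refine ⟨htwo i, fun u hu => ?_⟩
  rcases h.mem_or_adj (hz.two i).mem hu with hW | hW
  · obtain ⟨j, rfl⟩ := hz.exists_eq_of_adj hW hu
    exact htwo j _
  · exact ⟨x, fun hx => ((h.mem_iff _).1 (hz.two i).mem).1 hx.symm, hW.symm⟩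

theorem CorePair.exists_outer (h : G.DoubleStem x l₁ l₂ W) {a w : V} (hp : G.CorePair W a w) :
    ∃ y, G.Adj x y ∧ G.Adj w y ∧ (∀ u, G.Adj w u → u = a ∨ u = y) ∧
      ∃ m, G.LeafIn Finset.univ m y := by
  obtain ⟨y, hya, hwy⟩ := hp.core_leaf.1 a
  have hxy := (h.mem_or_adj hp.leaf.mem hwy).resolve_left fun hW =>
    hya (hp.leaf.eq_stem y hW hwy)
  refine ⟨y, hxy, hwy, fun u hwu => ?_,
    hp.core_leaf.exists_leafIn_of_adj hwy fun hy => h.not_adj_core hy hxy⟩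
  rcases h.mem_or_adj hp.leaf.mem hwu with hW | hW
  · exact Or.inl (hp.leaf.eq_stem u hW hwu)
  · exact Or.inr (h.eq_of_adj hp.leaf.mem hwu hwy hW hxy)

theorem CorePair.stem_eq_stem (h : G.DoubleStem x l₁ l₂ W) {a₁ a₂ a₃ w₁ w₂ w₃ : V}
    (hp₁ : G.CorePair W a₁ w₁) (hp₂ : G.CorePair W a₂ w₂) (hp₃ : G.CorePair W a₃ w₃)
    (h12 : G.Adj a₁ a₂) (h13 : G.Adj a₁ a₃) (ha₂ : a₂ ≠ w₁) (ha₃ : a₃ ≠ w₁) : a₂ = a₃ := by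
  classical
  by_contra h23
  have hg := h.noShort
  have hw₂ := hp₁.leaf_ne_stem hp₂ ha₂
  have hw₃ := hp₁.leaf_ne_stem hp₃ ha₃
  obtain ⟨y₁, hx₁, hy₁, hN₁, hm₁⟩ := hp₁.exists_outer h
  obtain ⟨y₂, hx₂, hy₂, hN₂, hm₂⟩ := hp₂.exists_outer h
  obtain ⟨y₃, hx₃, hy₃, hN₃, hm₃⟩ := hp₃.exists_outer h
  have hy12 : y₁ ≠ y₂ := by
    rintro rfl; exact hg.no5 h12 hp₂.leaf.adj.symm hy₂ hy₁.symm hp₁.leaf.adj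
  have hy13 : y₁ ≠ y₃ := by
    rintro rfl; exact hg.no5 h13 hp₃.leaf.adj.symm hy₃ hy₁.symm hp₁.leaf.adj
  set Y : Finset V := {y₂, y₃} with hY
  have hyY : y₁ ∉ Y := by simp [hY, hy12, hy13]
  have hZ : ∀ {y}, y ∈ insert y₁ Y → G.Adj x y ∧ ∃ m, G.LeafIn Finset.univ m y := by
    intro y hy
    simp only [hY, Finset.mem_insert, Finset.mem_singleton] at hy
    rcases hy with rfl | rfl | rfl
    exacts [⟨hx₁, hm₁⟩, ⟨hx₂, hm₂⟩, ⟨hx₃, hm₃⟩]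
  have hm : ∀ y, ∃ m, y ∈ insert y₁ Y → G.LeafIn Finset.univ m y := by
    intro y
    by_cases hy : y ∈ insert y₁ Y
    · exact (hZ hy).2.imp fun m hm _ => hm
    · exact ⟨y, fun h => (hy h).elim⟩
  choose m hm using hm
  have hYa : ∀ {y}, y ∈ Y → ¬ G.Adj y a₁ := by
    intro y hy hya
    simp only [hY, Finset.mem_insert, Finset.mem_singleton] at hy
    rcases hy with rfl | rfl
    · exact h.not_adj_core hp₂.core_stem
        ((hg.no4 h12 hp₂.leaf.adj.symm hy₂ hya hw₂.symm).symm ▸ hx₂)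
    · exact h.not_adj_core hp₃.core_stem
        ((hg.no4 h13 hp₃.leaf.adj.symm hy₃ hya hw₃.symm).symm ▸ hx₃)
  have hm₁ := hm y₁ (Finset.mem_insert_self _ _)
  set T : Finset V := {w₁, w₂, w₃} with hT
  have hTpair : ∀ {w}, w ∈ T → ∃ a, G.CorePair W a w := by
    intro w hw
    simp only [hT, Finset.mem_insert, Finset.mem_singleton] at hw
    rcases hw with rfl | rfl | rfl
    exacts [⟨_, hp₁⟩, ⟨_, hp₂⟩, ⟨_, hp₃⟩]
  have hTcard : T.card = 3 := by
    refine Finset.card_eq_three.2 ⟨w₁, w₂, w₃, ?_, ?_, ?_, rfl⟩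
    · rintro rfl
      exact h12.ne (hp₂.leaf.eq_stem a₁ hp₁.leaf.mem_stem hp₁.leaf.adj)
    · rintro rfl
      exact h13.ne (hp₃.leaf.eq_stem a₁ hp₁.leaf.mem_stem hp₁.leaf.adj)
    · rintro rfl
      exact h23 (hp₃.leaf.eq_stem a₂ hp₂.leaf.mem_stem hp₂.leaf.adj)
  have hTindep : G.Indep T := by
    have n12 : ¬ G.Adj w₁ w₂ := fun hw => hw₂ (hp₁.leaf.eq_stem _ hp₂.leaf.mem hw)
    have n13 : ¬ G.Adj w₁ w₃ := fun hw => hw₃ (hp₁.leaf.eq_stem _ hp₃.leaf.mem hw)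
    have n23 : ¬ G.Adj w₂ w₃ := by
      intro hw
      obtain rfl := hp₂.leaf.eq_stem _ hp₃.leaf.mem hw
      exact h13.ne (hp₃.leaf.eq_stem _ hp₁.leaf.mem_stem h12.symm)
    simp [hT, Indep, n12, n13, n23, G.adj_comm w₂ w₁, G.adj_comm w₃ w₁, G.adj_comm w₃ w₂]
  set M := (insert y₁ Y).image m with hM
  have memM : ∀ {b}, b ∈ M → ∃ y ∈ insert y₁ Y, G.LeafIn Finset.univ b y := by
    intro b hb
    obtain ⟨y, hy, rfl⟩ := Finset.mem_image.1 hb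
    exact ⟨y, hy, hm y hy⟩
  have hMcard : M.card = Y.card + 1 := by
    rw [hM, Finset.card_image_of_injOn, Finset.card_insert_of_notMem hyY]
    intro y hy y' hy' hyy
    have hyy : m y = m y' := hyy
    exact (hm y' hy').eq_stem y (Finset.mem_univ _) (hyy ▸ (hm y hy).adj)
  have hMT : ∀ b ∈ M, ∀ c ∈ M ∪ T, ¬ G.Adj b c := by
    intro b hb c hc hbc
    obtain ⟨y, hy, hby⟩ := memM hb
    obtain rfl := hby.eq_stem c (Finset.mem_univ _) hbc
    have hxc := (hZ hy).1
    rcases Finset.mem_union.1 hc with hc | hc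
    · obtain ⟨y', hy', hcy⟩ := memM hc
      exact (hZ hy').1.ne (hcy.eq_stem x (Finset.mem_univ _) hxc.symm)
    · obtain ⟨a, ha⟩ := hTpair hc
      exact h.not_adj_core ha.core_leaf hxc
  have hdisj : Disjoint M T := by
    rw [Finset.disjoint_left]
    intro b hb hbT
    obtain ⟨y, -, hby⟩ := memM hb
    obtain ⟨a, ha⟩ := hTpair hbT
    obtain ⟨c, hcy, hbc⟩ := ha.core_leaf.1 y
    exact hcy (hby.eq_stem c (Finset.mem_univ _) hbc)
  have hcard := h.gap (insert a₁ (insert (m y₁) Y)) (M ∪ T) (Finset.subset_univ _)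
    (Finset.subset_univ _) ?_ ?_ ?_
  · rw [Finset.card_union_of_disjoint hdisj, hMcard, hTcard] at hcard
    have := Finset.card_insert_le a₁ (insert (m y₁) Y)
    have := Finset.card_insert_le (m y₁) Y
    omega
  · have hmY : ∀ y ∈ Y, ¬ G.Adj (m y₁) y := fun y hy hadj =>
      hyY (hm₁.eq_stem y (Finset.mem_univ _) hadj ▸ hy)
    intro b hb c hc hbc
    rw [Finset.mem_insert, Finset.mem_insert] at hb hc
    rcases hb with rfl | rfl | hb <;> rcases hc with rfl | rfl | hc
    · exact hbc.ne rfl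
    · exact hp₁.core_stem.not_adj_leaf hm₁ hbc
    · exact hYa hc hbc.symm
    · exact hp₁.core_stem.not_adj_leaf hm₁ hbc.symm
    · exact hbc.ne rfl
    · exact hmY c hc hbc
    · exact hYa hb hbc
    · exact hmY b hb hbc.symm
    · exact hg.no3 (hZ (Finset.mem_insert_of_mem hb)).1 hbc
        (hZ (Finset.mem_insert_of_mem hc)).1.symm
  · intro b hb c hc hbc
    rcases Finset.mem_union.1 hb with hb' | hb'
    · exact hMT b hb' c hc hbc
    rcases Finset.mem_union.1 hc with hc' | hc'
    · exact hMT c hc' b hb hbc.symm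
    · exact hTindep b hb' c hc' hbc
  · set A := insert a₁ (insert (m y₁) Y) with hA
    have ha₁ : a₁ ∈ A := Finset.mem_insert_self _ _
    have hmA : m y₁ ∈ A := Finset.mem_insert_of_mem (Finset.mem_insert_self _ _)
    have hYA : ∀ {y}, y ∈ Y → y ∈ A := fun hy =>
      Finset.mem_insert_of_mem (Finset.mem_insert_of_mem hy)
    have hy₂Y : y₂ ∈ Y := Finset.mem_insert_self _ _
    have hy₃Y : y₃ ∈ Y := Finset.mem_insert_of_mem (Finset.mem_singleton_self _)
    have hZA : ∀ {y}, y ∈ insert y₁ Y → G.DominatedBy A y := by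
      intro y hy
      rcases Finset.mem_insert.1 hy with rfl | hy
      · exact Or.inr ⟨_, hmA, hm₁.adj⟩
      · exact Or.inl (hYA hy)
    intro b hb
    rcases Finset.mem_union.1 hb with hb | hb
    · obtain ⟨y, hy, rfl⟩ := Finset.mem_image.1 hb
      refine ⟨?_, fun u hu hbu => (hm y hy).eq_stem u hu hbu ▸ hZA hy⟩
      rcases Finset.mem_insert.1 hy with rfl | hy'
      · exact Or.inl hmA
      · exact Or.inr ⟨y, hYA hy', (hm y hy).adj.symm⟩
    · simp only [hT, Finset.mem_insert, Finset.mem_singleton] at hb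
      rcases hb with rfl | rfl | rfl
      · refine ⟨Or.inr ⟨a₁, ha₁, hp₁.leaf.adj.symm⟩, fun u _ hu => ?_⟩
        rcases hN₁ u hu with rfl | rfl
        exacts [Or.inl ha₁, hZA (Finset.mem_insert_self _ _)]
      · refine ⟨Or.inr ⟨y₂, hYA hy₂Y, hy₂.symm⟩, fun u _ hu => ?_⟩
        rcases hN₂ u hu with rfl | rfl
        exacts [Or.inr ⟨a₁, ha₁, h12⟩, Or.inl (hYA hy₂Y)]
      · refine ⟨Or.inr ⟨y₃, hYA hy₃Y, hy₃.symm⟩, fun u _ hu => ?_⟩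
        rcases hN₃ u hu with rfl | rfl
        exacts [Or.inr ⟨a₁, ha₁, h13⟩, Or.inl (hYA hy₃Y)]

theorem CorePair.exists_corePair_of_adj (h : G.DoubleStem x l₁ l₂ W) {a b w : V}
    (hp : G.CorePair W a w) (hb : G.IsCore b) (hab : G.Adj a b) (hbw : b ≠ w) :
    ∃ w', G.CorePair W b w' := by
  rcases h.core_cases hb with ⟨z, hz, rfl⟩ | ⟨a', w', hp', rfl | rfl⟩
  · obtain ⟨i, rfl⟩ := hz.exists_eq_of_adj hp.leaf.mem_stem hab.symm
    obtain ⟨j, rfl⟩ := hz.exists_eq_of_adj hp.leaf.mem hp.leaf.adj.symm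
    exact (hz.not_leafIn hp.leaf).elim
  · exact ⟨w', hp'⟩
  · obtain rfl := hp'.leaf.eq_stem a hp.leaf.mem_stem hab.symm
    exact (hbw (hp'.leaf.unique h.noShort h.gapLE hp.leaf)).elim

end DoubleStem

end SimpleGraph

/-- In an almost well-covered graph of girth at least 6 with exactly one
vertex of type 2, every component of `G₀` is isomorphic to `K₁`, `K₂`, `P₄`, or `C₇`. -/
theorem components_of_G0_one_type2 {V : Type*} [Fintype V] (G : SimpleGraph V)
    (h : AlmostWellCovered G) (hg : GirthAtLeastSix G)
    (x : V) (hx : HasType G x 2) (honly : ∀ v : V, HasType G v 2 → v = x)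
    (c : (G.induce (typeSet G 0)).ConnectedComponent) :
    Nonempty ((G.induce (typeSet G 0)).induce c.supp ≃g (⊤ : SimpleGraph (Fin 1))) ∨
    Nonempty ((G.induce (typeSet G 0)).induce c.supp ≃g (⊤ : SimpleGraph (Fin 2))) ∨
    Nonempty ((G.induce (typeSet G 0)).induce c.supp ≃g SimpleGraph.pathGraph 4) ∨
    Nonempty ((G.induce (typeSet G 0)).induce c.supp ≃g SimpleGraph.cycleGraph 7) := by
  classical
  have hg' := hg.noShortCycle
  obtain ⟨l₁, l₂, hne, hl₁, hl₂⟩ := SimpleGraph.exists_leaves_of_hasType_two hx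
  let W := Finset.univ.filter fun u => u ≠ x ∧ ¬ G.Adj x u
  have hD : G.DoubleStem x l₁ l₂ W := ⟨hg', h.gapLE, hne, hl₁, hl₂, by simp [W]⟩
  have hmem : ∀ {v}, G.IsCore v → v ∈ typeSet G 0 := fun hv =>
    (SimpleGraph.mem_typeSet_zero_iff hg').2 (Or.inr hv)
  have hcore : ∀ {v w}, G.IsCore v → w ∈ typeSet G 0 → G.Adj v w → G.IsCore w :=
    fun hv hw hvw => ((SimpleGraph.mem_typeSet_zero_iff hg').1 hw).resolve_left fun hU =>
      hv.notMem_completeU hg' (SimpleGraph.mem_completeU_of_adj hU hvw.symm)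
  obtain ⟨⟨u, hu⟩, rfl⟩ := c.exists_rep
  rcases (SimpleGraph.mem_typeSet_zero_iff hg').1 hu with hU | hu'
  · by_cases hno : ∃ v, G.Adj u v
    · obtain ⟨v, huv⟩ := hno
      have hU' := SimpleGraph.mem_completeU_of_adj hU huv
      have huniq : ∀ {s t w}, s ∈ completeU G → G.Adj s t → G.Adj s w → w = t := by
        intro s t w hs hst hsw
        by_contra hwt
        exact hg'.no3 hst (SimpleGraph.adj_of_mem_completeU hs hst hsw (Ne.symm hwt)) hsw.symm
      exact Or.inr (Or.inl (SimpleGraph.nonempty_component_iso_two hu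
        ((SimpleGraph.mem_typeSet_zero_iff hg').2 (Or.inl hU')) huv
        (fun w _ hw => huniq hU huv hw) (fun w _ hw => huniq hU' huv.symm hw) (Or.inl rfl)))
    · push Not at hno
      exact Or.inl (SimpleGraph.nonempty_component_iso SimpleGraph.preconnected_top
        (fun _ => u) (fun i j _ => Subsingleton.elim i j) (fun _ => hu)
        (fun i j => by simp [Subsingleton.elim i j])
        (fun _ v _ huv => (hno v huv).elim) ⟨0, rfl⟩)
  rcases hD.core_cases hu' with ⟨z, hz, hzu⟩ | ⟨a, w, hp, huaw⟩
  · refine Or.inr (Or.inr (Or.inr (SimpleGraph.nonempty_component_iso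
      SimpleGraph.cycleGraph_preconnected z hz.inj (fun i => hmem (hD.core_of_heptagon hz i))
      (fun i j => ?_) (fun i v hv hiv => ?_) ⟨0, hzu⟩)))
    · rw [SimpleGraph.cycleGraph_adj]
      constructor
      · intro hij
        rcases (hz.two i).eq_or _ (hz.two j).mem hij with hj | hj <;> obtain rfl := hz.inj hj
        · right; simp
        · left; clear hij hj; revert i; decide
      · rintro (hij | hij)
        · obtain rfl := eq_add_of_sub_eq' hij
          exact (hz.two j).adjL.symm
        · obtain rfl := eq_add_of_sub_eq' hij
          exact (hz.two i).adjL
    · exact hz.exists_eq_of_adj (hD.mem_of_core (hcore (hD.core_of_heptagon hz i) hv hiv)) hiv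
  · have hleaf : ∀ {a w}, G.CorePair W a w → ∀ v ∈ typeSet G 0, G.Adj w v → v = a :=
      fun hp v hv hwv => hp.leaf.eq_stem v (hD.mem_of_core (hcore hp.core_leaf hv hwv)) hwv
    by_cases hother : ∃ b, b ≠ w ∧ G.IsCore b ∧ G.Adj a b
    · obtain ⟨b, hbw, hb, hab⟩ := hother
      obtain ⟨w', hp'⟩ := hp.exists_corePair_of_adj hD hb hab hbw
      have hstem : ∀ {a w b w'}, G.CorePair W a w → G.CorePair W b w' → b ≠ w → G.Adj a b →
          ∀ v ∈ typeSet G 0, G.Adj a v → v = w ∨ v = b := by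
        intro a w b w' hp hp' hbw hab v hv hav
        by_cases hvw : v = w
        · exact Or.inl hvw
        · obtain ⟨w'', hp''⟩ := hp.exists_corePair_of_adj hD (hcore hp.core_stem hv hav) hav hvw
          exact Or.inr (hp.stem_eq_stem hD hp'' hp' hav hab hvw hbw)
      have hw'a := hp.leaf_ne_stem hp' hbw
      exact Or.inr (Or.inr (Or.inl (SimpleGraph.nonempty_component_iso_four hg'
        (hmem hp.core_leaf) (hmem hp.core_stem) (hmem hb) (hmem hp'.core_leaf) hp.leaf.adj hab
        hp'.leaf.adj.symm hbw hw'a (hleaf hp) (hstem hp hp' hbw hab)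
        (hstem hp' hp hw'a.symm hab.symm) (hleaf hp') huaw)))
    · refine Or.inr (Or.inl (SimpleGraph.nonempty_component_iso_two (hmem hp.core_stem)
        (hmem hp.core_leaf) hp.leaf.adj.symm (fun v hv hav => ?_) (hleaf hp) huaw))
      by_contra hvw
      exact hother ⟨v, hvw, hcore hp.core_stem hv hav, hav⟩
end

section
/- Let G be an almost well-covered finite simple graph containing no cycle of length 3, 4, 5, or 7. Then every vertex of G_0 has degree at most 2 in G_0. -/
section ClosedWalks

variable {V : Type*} {G : SimpleGraph V}

theorem NoCycleOfLength.three_closed (h3 : NoCycleOfLength G 3) {a b c : V}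
    (hab : G.Adj a b) (hbc : G.Adj b c) (hca : G.Adj c a) : False := by
  have h := h3 a (.cons hab (.cons hbc (.cons hca .nil)))
  simp [SimpleGraph.Walk.cons_isCycle_iff] at h
  grind [SimpleGraph.Adj.ne]

theorem NoCycleOfLength.four_closed (h4 : NoCycleOfLength G 4) {a b c d : V}
    (hab : G.Adj a b) (hbc : G.Adj b c) (hcd : G.Adj c d) (hda : G.Adj d a)
    (hac : a ≠ c) (hbd : b ≠ d) : False := by
  have h := h4 a (.cons hab (.cons hbc (.cons hcd (.cons hda .nil))))
  simp [SimpleGraph.Walk.cons_isCycle_iff] at h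
  grind [SimpleGraph.Adj.ne]

/-- Without cycles of length 3 and 5 there are no closed walks of length 5 at all. -/
theorem NoCycleOfLength.five_closed (h3 : NoCycleOfLength G 3) (h5 : NoCycleOfLength G 5)
    {a b c d e : V} (hab : G.Adj a b) (hbc : G.Adj b c) (hcd : G.Adj c d)
    (hde : G.Adj d e) (hea : G.Adj e a) : False := by
  have h := h5 a (.cons hab (.cons hbc (.cons hcd (.cons hde (.cons hea .nil)))))
  simp [SimpleGraph.Walk.cons_isCycle_iff] at h
  have hac : a ≠ c := by rintro rfl; exact h3.three_closed hcd hde hea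
  have hbd : b ≠ d := by rintro rfl; exact h3.three_closed hde hea hab
  have hce : c ≠ e := by rintro rfl; exact h3.three_closed hea hab hbc
  have hda : d ≠ a := by rintro rfl; exact h3.three_closed hab hbc hcd
  have heb : e ≠ b := by rintro rfl; exact h3.three_closed hbc hcd hde
  grind [SimpleGraph.Adj.ne]

/-- Without cycles of length 3, 5 and 7 there are no closed walks of length 7 at all. -/
theorem NoCycleOfLength.seven_closed (h3 : NoCycleOfLength G 3) (h5 : NoCycleOfLength G 5)
    (h7 : NoCycleOfLength G 7) {a b c d e f g : V} (hab : G.Adj a b) (hbc : G.Adj b c)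
    (hcd : G.Adj c d) (hde : G.Adj d e) (hef : G.Adj e f) (hfg : G.Adj f g)
    (hga : G.Adj g a) : False := by
  have h := h7 a (.cons hab (.cons hbc (.cons hcd (.cons hde (.cons hef
    (.cons hfg (.cons hga .nil)))))))
  simp [SimpleGraph.Walk.cons_isCycle_iff] at h
  have t : ∀ {x y z : V}, G.Adj x y → G.Adj y z → G.Adj z x → False := h3.three_closed
  have p : ∀ {x y z u w : V}, G.Adj x y → G.Adj y z → G.Adj z u → G.Adj u w → G.Adj w x →
    False := h3.five_closed h5
  have hac : a ≠ c := by rintro rfl; exact p hcd hde hef hfg hga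
  have hbd : b ≠ d := by rintro rfl; exact p hde hef hfg hga hab
  have hce : c ≠ e := by rintro rfl; exact p hef hfg hga hab hbc
  have hdf : d ≠ f := by rintro rfl; exact p hfg hga hab hbc hcd
  have heg : e ≠ g := by rintro rfl; exact p hga hab hbc hcd hde
  have hfa : f ≠ a := by rintro rfl; exact p hab hbc hcd hde hef
  have hgb : g ≠ b := by rintro rfl; exact p hbc hcd hde hef hfg
  have had : a ≠ d := by rintro rfl; exact t hab hbc hcd
  have hbe : b ≠ e := by rintro rfl; exact t hbc hcd hde
  have hcf : c ≠ f := by rintro rfl; exact t hcd hde hef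
  have hdg : d ≠ g := by rintro rfl; exact t hde hef hfg
  have hea : e ≠ a := by rintro rfl; exact t hef hfg hga
  have hfb : f ≠ b := by rintro rfl; exact t hfg hga hab
  have hgc : g ≠ c := by rintro rfl; exact t hga hab hbc
  grind [SimpleGraph.Adj.ne]

end ClosedWalks

section IndependentSets

variable {V : Type*} {G : SimpleGraph V}

theorem IndepSet.ncard_le_alphaNum [Finite V] {s : Set V} (hs : IndepSet G s) :
    s.ncard ≤ alphaNum G := by
  refine le_csSup ⟨Nat.card V, ?_⟩ ⟨s, hs, rfl⟩
  rintro n ⟨t, -, rfl⟩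
  exact Set.ncard_le_card t

theorem MaxIndepSet.iNum_le_ncard {s : Set V} (hs : MaxIndepSet G s) :
    iNum G ≤ s.ncard :=
  Nat.sInf_le ⟨s, hs, rfl⟩

theorem IndepSet.exists_maxIndepSet_superset [Finite V] {s : Set V} (hs : IndepSet G s) :
    ∃ t, s ⊆ t ∧ MaxIndepSet G t := by
  obtain ⟨t, hst, ht⟩ := (Set.toFinite {t | IndepSet G t}).exists_le_maximal hs
  exact ⟨t, hst, ht.prop, fun u hu htu => ht.eq_of_le hu htu⟩

end IndependentSets

section TypeZero

variable {V : Type*} {G : SimpleGraph V}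

theorem mem_completeU_congr {u w : V} (h : G.Adj u w) :
    u ∈ completeU G ↔ w ∈ completeU G := by
  have : G.connectedComponentMk u = G.connectedComponentMk w :=
    SimpleGraph.ConnectedComponent.sound h.reachable
  simp [completeU, this]

theorem NoCycleOfLength.eq_of_mem_completeU (h3 : NoCycleOfLength G 3) {a v x : V}
    (ha : a ∈ completeU G) (hav : G.Adj a v) (hax : G.Adj a x) : x = v := by
  by_contra hne
  have hx : x ∈ (G.connectedComponentMk a).supp :=
    SimpleGraph.ConnectedComponent.sound hax.symm.reachable
  have hv : v ∈ (G.connectedComponentMk a).supp :=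
    SimpleGraph.ConnectedComponent.sound hav.symm.reachable
  exact h3.three_closed hax (ha hx hv hne) hav.symm

/-- In a triangle-free graph, if `a` has type `0` and two distinct neighbors `v` and `x`, then
`x` has a neighbor other than `a`. -/
theorem exists_adj_ne_of_mem_typeSet_zero [Finite V] (h3 : NoCycleOfLength G 3) {a v x : V}
    (ha : a ∈ typeSet G 0) (hav : G.Adj a v) (hax : G.Adj a x) (hxv : x ≠ v) :
    ∃ y, G.Adj x y ∧ y ≠ a := by
  rcases ha with ⟨⟨haU, -⟩, hcard⟩ | ⟨haU, -⟩
  · have hxU : x ∉ completeU G := fun h => haU ((mem_completeU_congr hax).2 h)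
    by_contra! hy
    refine (Set.eq_empty_iff_forall_notMem.1 ((Set.ncard_eq_zero).1 hcard) x) ⟨⟨hxU, ?_⟩, hax⟩
    rw [Set.ncard_eq_one]
    refine ⟨a, Set.ext fun u => ⟨fun hu => hy u hu.2, ?_⟩⟩
    rintro rfl
    exact ⟨haU, hax.symm⟩
  · exact absurd (h3.eq_of_mem_completeU haU hav hax) hxv

end TypeZero

/-- In an almost well-covered graph with no cycle of length 3, 4, 5, or 7,
every vertex of `G₀` has degree at most 2 in `G₀`. -/
theorem degree_le_two_in_G0 {V : Type*} [Fintype V] (G : SimpleGraph V)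
    (h : AlmostWellCovered G)
    (h3 : NoCycleOfLength G 3) (h4 : NoCycleOfLength G 4)
    (h5 : NoCycleOfLength G 5) (h7 : NoCycleOfLength G 7)
    (v : V) (hv : v ∈ typeSet G 0) :
    ((G.induce (typeSet G 0)).neighborSet ⟨v, hv⟩).ncard ≤ 2 := by
  let A : Set V := {a | a ∈ typeSet G 0 ∧ G.Adj v a}
  have hA : ((G.induce (typeSet G 0)).neighborSet ⟨v, hv⟩).ncard = A.ncard := by
    rw [← Set.ncard_image_of_injective _ Subtype.val_injective]
    congr 1
    ext a
    simp [A, and_comm]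
  rw [hA]
  let S : Set V := {y | ∃ a ∈ A, ∃ x, x ≠ v ∧ y ≠ a ∧ G.Adj a x ∧ G.Adj x y}
  have hvS : ∀ y ∈ S, ¬ G.Adj v y := by
    rintro y ⟨a, ⟨-, hva⟩, x, hxv, hya, hax, hxy⟩ hvy
    exact h4.four_closed hva hax hxy hvy.symm hxv.symm hya.symm
  have hS : IndepSet G (insert v S) := by
    rintro y (rfl | hy) z (rfl | hz) hyz
    · exact hyz.ne rfl
    · exact hvS z hz hyz
    · exact hvS y hy hyz.symm
    · obtain ⟨a, ⟨-, hva⟩, x, -, -, hax, hxy⟩ := hy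
      obtain ⟨b, ⟨-, hvb⟩, w, -, -, hbw, hwz⟩ := hz
      exact h3.seven_closed h5 h7 hva hax hxy hyz hwz.symm hbw.symm hvb.symm
  obtain ⟨M, hSM, hM⟩ := hS.exists_maxIndepSet_superset
  have hvM : v ∈ M := hSM (Set.mem_insert v S)
  have hMA : ∀ x ∈ M \ {v}, ∀ a ∈ A, ¬ G.Adj a x := by
    rintro x ⟨hxM, hxv⟩ a ha hax
    obtain ⟨y, hxy, hya⟩ := exists_adj_ne_of_mem_typeSet_zero h3 ha.1 ha.2.symm hax hxv
    exact hM.1 hxM (hSM (Set.mem_insert_of_mem v ⟨a, ha, x, hxv, hya, hax, hxy⟩)) hxy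
  have hind : IndepSet G (M \ {v} ∪ A) := by
    rintro x (hx | hx) y (hy | hy) hxy
    · exact hM.1 hx.1 hy.1 hxy
    · exact hMA x hx y hy hxy.symm
    · exact hMA y hy x hx hxy
    · exact h3.three_closed hx.2 hxy hy.2.symm
  have hdisj : Disjoint (M \ {v}) A :=
    Set.disjoint_left.2 fun a haM ha => hM.1 hvM haM.1 ha.2
  have hcard := hind.ncard_le_alphaNum
  rw [Set.ncard_union_eq hdisj] at hcard
  have hMcard := Set.ncard_sdiff_singleton_add_one hvM
  have hi := hM.iNum_le_ncard
  unfold AlmostWellCovered indepGap at h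
  omega
end

section
/- Let G be an almost well-covered finite simple graph containing no cycle of length 3, 4, 5, or 7 and having no vertex of type 2. Then every connected component of G_0 is isomorphic to one of the paths P_1, P_2, P_3, P_4, P_5, P_6, P_7, P_8, P_{10} or one of the cycles C_6, C_8, C_9, C_{10}, C_{11}, C_{13}. -/
section Cycles

variable {V : Type*} {G : SimpleGraph V}

lemma NoCycleOfLength.not_triangle (h : NoCycleOfLength G 3) {a b c : V}
    (hab : G.Adj a b) (hbc : G.Adj b c) (hca : G.Adj c a) : False := by
  refine h a (.cons hab (.cons hbc (.cons hca .nil))) ?_ rfl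
  have := hab.ne
  have := hbc.ne
  have := hca.ne
  rw [SimpleGraph.Walk.cons_isCycle_iff]
  simp [SimpleGraph.Walk.isPath_def]
  grind

lemma NoCycleOfLength.not_square (h : NoCycleOfLength G 4) {a b c d : V}
    (hab : G.Adj a b) (hbc : G.Adj b c) (hcd : G.Adj c d) (hda : G.Adj d a)
    (hac : a ≠ c) (hbd : b ≠ d) : False := by
  refine h a (.cons hab (.cons hbc (.cons hcd (.cons hda .nil)))) ?_ rfl
  have := hab.ne
  have := hbc.ne
  have := hcd.ne
  have := hda.ne
  rw [SimpleGraph.Walk.cons_isCycle_iff]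
  simp [SimpleGraph.Walk.isPath_def]
  grind

lemma NoCycleOfLength.not_pentagon (h : NoCycleOfLength G 5) {a b c d e : V}
    (hab : G.Adj a b) (hbc : G.Adj b c) (hcd : G.Adj c d) (hde : G.Adj d e) (hea : G.Adj e a)
    (hnd : [a, b, c, d, e].Nodup) : False := by
  refine h a (.cons hab (.cons hbc (.cons hcd (.cons hde (.cons hea .nil))))) ?_ rfl
  rw [SimpleGraph.Walk.cons_isCycle_iff]
  simp [SimpleGraph.Walk.isPath_def] at hnd ⊢
  grind

lemma NoCycleOfLength.not_heptagon (h : NoCycleOfLength G 7) {a b c d e f g : V}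
    (hab : G.Adj a b) (hbc : G.Adj b c) (hcd : G.Adj c d) (hde : G.Adj d e) (hef : G.Adj e f)
    (hfg : G.Adj f g) (hga : G.Adj g a) (hnd : [a, b, c, d, e, f, g].Nodup) : False := by
  refine h a (.cons hab (.cons hbc (.cons hcd (.cons hde (.cons hef
    (.cons hfg (.cons hga .nil))))))) ?_ rfl
  rw [SimpleGraph.Walk.cons_isCycle_iff]
  simp [SimpleGraph.Walk.isPath_def] at hnd ⊢
  grind

end Cycles

section Exchange

variable {V : Type*} [Fintype V] {G : SimpleGraph V}

lemma AlmostWellCovered.ncard_le (h : AlmostWellCovered G) {S T : Set V}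
    (hS : MaxIndepSet G S) (hT : IndepSet G T) : T.ncard ≤ S.ncard + 1 := by
  have hα : T.ncard ≤ alphaNum G := by
    refine le_csSup ⟨Fintype.card V, ?_⟩ ⟨T, hT, rfl⟩
    rintro n ⟨s, -, rfl⟩
    rw [← Nat.card_eq_fintype_card]
    exact s.ncard_le_card
  have hi : iNum G ≤ S.ncard := Nat.sInf_le ⟨S, hS, rfl⟩
  unfold AlmostWellCovered indepGap at h
  omega

lemma IndepSet.exists_maxIndepSet {P : Set V} (hP : IndepSet G P) :
    ∃ S, P ⊆ S ∧ MaxIndepSet G S := by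
  obtain ⟨S, hPS, hS⟩ := Finite.exists_le_maximal (p := IndepSet G) hP
  exact ⟨S, hPS, hS.1, fun t ht hst ↦ hst.antisymm (hS.2 ht hst)⟩

/-- If every vertex of the closed neighborhood of `T` lies in `S` or is dominated by the
independent set `P ⊇ S`, then replacing `S` by `T` in a maximal independent set containing `P`
preserves independence. -/
lemma AlmostWellCovered.ncard_le_of_exchange (h : AlmostWellCovered G) {P S T : Set V}
    (hP : IndepSet G P) (hSP : S ⊆ P) (hT : IndepSet G T)
    (hdom : ∀ t ∈ T, ∀ x, x = t ∨ G.Adj x t → x ∈ S ∨ ∃ p ∈ P, G.Adj p x) :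
    T.ncard ≤ S.ncard + 1 := by
  obtain ⟨M, hPM, hM⟩ := hP.exists_maxIndepSet
  have key : ∀ x ∈ M \ S, ∀ t ∈ T, ¬ (x = t ∨ G.Adj x t) := by
    intro x hx t ht hxt
    obtain hxS | ⟨p, hp, hpx⟩ := hdom t ht x hxt
    · exact hx.2 hxS
    · exact hM.1 (hPM hp) hx.1 hpx
  have hI : IndepSet G (M \ S ∪ T) := by
    rintro a (ha | ha) b (hb | hb) hab
    · exact hM.1 ha.1 hb.1 hab
    · exact key a ha b hb (.inr hab)
    · exact key b hb a ha (.inr hab.symm)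
    · exact hT ha hb hab
  have hd : Disjoint (M \ S) T :=
    Set.disjoint_left.2 fun x hx hxT ↦ key x hx x hxT (.inl rfl)
  have h₁ := h.ncard_le hM hI
  rw [Set.ncard_union_eq hd] at h₁
  have h₂ := Set.ncard_sdiff_add_ncard_of_subset (hSP.trans hPM)
  omega

end Exchange

section Types

variable {V : Type*} {G : SimpleGraph V}

lemma mem_completeU_of_adj {u v : V} (huv : G.Adj u v) (hu : u ∈ completeU G) :
    v ∈ completeU G := by
  have : G.connectedComponentMk u = G.connectedComponentMk v :=
    SimpleGraph.ConnectedComponent.sound huv.reachable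
  simpa [completeU, this] using hu

lemma IsLeaf.eq_of_adj {u v w : V} (hu : IsLeaf G u) (hv : G.Adj u v) (hw : G.Adj u w) :
    v = w := by
  obtain ⟨x, hx⟩ := Set.ncard_eq_one.1 hu.2
  have hmem : ∀ y, G.Adj u y → y = x := fun y hy ↦ by
    have : y ∈ {y | y ∉ completeU G ∧ G.Adj u y} :=
      ⟨fun hyU ↦ hu.1 (mem_completeU_of_adj hy.symm hyU), hy⟩
    rwa [hx] at this
  rw [hmem v hv, hmem w hw]

lemma IsLeaf.not_adj {u v : V} (hu : IsLeaf G u) (hv : IsLeaf G v) : ¬ G.Adj u v := by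
  intro huv
  have hreach : ∀ x, G.Reachable u x → x = u ∨ x = v := by
    intro x hx
    rw [SimpleGraph.reachable_iff_reflTransGen] at hx
    induction hx with
    | refl => exact .inl rfl
    | tail _ hbc ih =>
      obtain rfl | rfl := ih
      · exact .inr (hu.eq_of_adj hbc huv)
      · exact .inl (hv.eq_of_adj hbc huv.symm)
  refine hu.1 fun x hx y hy hxy ↦ ?_
  rw [SimpleGraph.ConnectedComponent.mem_supp_iff, SimpleGraph.ConnectedComponent.eq] at hx hy
  obtain rfl | rfl := hreach x hx.symm <;> obtain rfl | rfl := hreach y hy.symm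
  exacts [absurd rfl hxy, huv, huv.symm, absurd rfl hxy]

/-- The vertices at the end of a path of length three starting at `v`. -/
def thirdNeighbors (G : SimpleGraph V) (v : V) : Set V :=
  {d | ∃ x y, G.Adj v x ∧ G.Adj x y ∧ G.Adj y d ∧ y ≠ v ∧ d ≠ x}

lemma indepSet_insert_thirdNeighbors
    (h3 : NoCycleOfLength G 3) (h4 : NoCycleOfLength G 4)
    (h5 : NoCycleOfLength G 5) (h7 : NoCycleOfLength G 7) (v : V) :
    IndepSet G (insert v (thirdNeighbors G v)) := by
  have hv : ∀ d ∈ thirdNeighbors G v, ¬ G.Adj v d := by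
    rintro d ⟨x, y, hvx, hxy, hyd, hyv, hdx⟩ hvd
    exact h4.not_square hvx hxy hyd hvd.symm hyv.symm hdx.symm
  rintro d (rfl | hd) e (rfl | he) hde
  · exact hde.ne rfl
  · exact hv e he hde
  · exact hv d hd hde.symm
  obtain ⟨x, y, hvx, hxy, hyd, hyv, hdx⟩ := hd
  obtain ⟨x', y', hvx', hxy', hye', hyv', hex'⟩ := he
  by_cases hxx : x = x'
  · subst hxx
    by_cases hyy : y = y'
    · subst hyy
      exact h3.not_triangle hyd hde hye'.symm
    · refine h5.not_pentagon hxy hyd hde hye'.symm hxy'.symm ?_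
      have hdy : d ≠ y' := by rintro rfl; exact h3.not_triangle hxy hyd hxy'.symm
      have hey : y ≠ e := by rintro rfl; exact h3.not_triangle hxy hye'.symm hxy'.symm
      have := hxy.ne
      have := hyd.ne
      have := hde.ne
      have := hye'.ne
      have := hxy'.ne
      simp
      grind
  · have hyy : y ≠ y' := by
      rintro rfl; exact h4.not_square hvx hxy hxy'.symm hvx'.symm hyv.symm hxx
    have hxy₁ : x ≠ y' := by rintro rfl; exact h3.not_triangle hvx hxy'.symm hvx'.symm
    have hxy₂ : y ≠ x' := by rintro rfl; exact h3.not_triangle hvx hxy hvx'.symm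
    have hvd : v ≠ d := by rintro rfl; exact h3.not_triangle hvx hxy hyd
    have hve : v ≠ e := by rintro rfl; exact h3.not_triangle hvx' hxy' hye'
    have hdx' : d ≠ x' := by
      rintro rfl; exact h4.not_square hvx hxy hyd hvx'.symm hyv.symm hxx
    have hex : e ≠ x := by
      rintro rfl; exact h4.not_square hvx' hxy' hye' hvx.symm hyv'.symm (Ne.symm hxx)
    have := hvx.ne
    have := hxy.ne
    have := hyd.ne
    have := hde.ne
    have := hye'.ne
    have := hxy'.ne
    have := hvx'.ne
    have hdy : d ≠ y' := by
      rintro rfl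
      refine h5.not_pentagon hvx hxy hyd hxy'.symm hvx'.symm ?_
      simp
      grind
    have hey : e ≠ y := by
      rintro rfl
      refine h5.not_pentagon hvx' hxy' hye' hxy.symm hvx.symm ?_
      simp
      grind
    refine h7.not_heptagon hvx hxy hyd hde hye'.symm hxy'.symm hvx'.symm ?_
    simp
    grind

variable [Fintype V]

lemma HasType.not_adj_leaf {u v : V} (hv : HasType G v 0) (hu : IsLeaf G u) :
    ¬ G.Adj u v := by
  intro huv
  obtain ⟨-, h0⟩ | ⟨hU, -⟩ := hv
  · rw [Set.ncard_eq_zero] at h0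
    exact Set.eq_empty_iff_forall_notMem.1 h0 u ⟨hu, huv.symm⟩
  · exact hu.1 (mem_completeU_of_adj huv.symm hU)

lemma exists_leaf_adj_of_not_hasType_zero {v : V} (hv : ¬ HasType G v 0) (hl : ¬ IsLeaf G v) :
    ∃ u, IsLeaf G u ∧ G.Adj u v := by
  by_contra! hno
  refine hv ?_
  by_cases hU : v ∈ completeU G
  · exact .inr ⟨hU, rfl⟩
  · refine .inl ⟨⟨hU, hl⟩, ?_⟩
    rw [Set.ncard_eq_zero, Set.eq_empty_iff_forall_notMem]
    exact fun u hu ↦ hno u hu.1 hu.2.symm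

lemma HasType.exists_adj_ne {a x : V} (ha : HasType G a 0) (haU : a ∉ completeU G)
    (hax : G.Adj a x) : ∃ d, G.Adj x d ∧ d ≠ a := by
  by_contra! hno
  have hx : x ∉ completeU G := fun hx ↦ haU (mem_completeU_of_adj hax.symm hx)
  refine ha.not_adj_leaf ⟨hx, Set.ncard_eq_one.2 ⟨a, ?_⟩⟩ hax.symm
  ext d
  exact ⟨fun hd ↦ hno d hd.2, fun hd ↦ by rw [Set.mem_singleton_iff.1 hd]; exact ⟨haU, hax.symm⟩⟩

/-- A vertex of an almost well-covered graph without cycles of length `3`, `4`, `5`, `7` has at most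
two neighbors of type `0`. -/
lemma AlmostWellCovered.eq_of_adj_type_zero (h : AlmostWellCovered G)
    (h3 : NoCycleOfLength G 3) (h4 : NoCycleOfLength G 4)
    (h5 : NoCycleOfLength G 5) (h7 : NoCycleOfLength G 7) {v a b c : V}
    (ha : HasType G a 0) (hb : HasType G b 0) (hc : HasType G c 0)
    (hva : G.Adj v a) (hvb : G.Adj v b) (hvc : G.Adj v c) : a = b ∨ b = c ∨ a = c := by
  by_contra! hne
  obtain ⟨hab, hbc, hac⟩ := hne
  have hvU : v ∉ completeU G := by
    intro hv
    have hmem : ∀ x, G.Adj v x → x ∈ (G.connectedComponentMk v).supp := fun x hx ↦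
      SimpleGraph.ConnectedComponent.sound hx.symm.reachable
    exact h3.not_triangle hva (hv (hmem a hva) (hmem b hvb) hab) hvb.symm
  have hdom : ∀ t, HasType G t 0 → G.Adj v t → ∀ x, x = t ∨ G.Adj x t →
      x ∈ ({v} : Set V) ∨ ∃ p ∈ insert v (thirdNeighbors G v), G.Adj p x := by
    rintro t ht hvt x (rfl | hxt)
    · exact .inr ⟨v, .inl rfl, hvt⟩
    · by_cases hxv : x = v
      · exact .inl hxv
      have htU : t ∉ completeU G := fun htU ↦ hvU (mem_completeU_of_adj hvt.symm htU)
      obtain ⟨d, hxd, hdt⟩ := ht.exists_adj_ne htU hxt.symm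
      exact .inr ⟨d, .inr ⟨t, x, hvt, hxt.symm, hxd, hxv, hdt⟩, hxd.symm⟩
  have hadj : ∀ t ∈ ({a, b, c} : Set V), G.Adj v t := by
    rintro t (rfl | rfl | rfl) <;> assumption
  have htype : ∀ t ∈ ({a, b, c} : Set V), HasType G t 0 := by
    rintro t (rfl | rfl | rfl) <;> assumption
  have hle := h.ncard_le_of_exchange (S := {v}) (T := {a, b, c})
    (indepSet_insert_thirdNeighbors h3 h4 h5 h7 v) (by simp)
    (fun x hx y hy hxy ↦ h3.not_triangle (hadj x hx) hxy (hadj y hy).symm)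
    (fun t ht ↦ hdom t (htype t ht) (hadj t ht))
  rw [Set.ncard_singleton, Set.ncard_eq_three.2 ⟨a, b, c, hab, hac, hbc, rfl⟩] at hle
  omega

/-- In every component of `G₀`, the size of an independent set exceeds the size of an independent
dominating set by at most one. -/
lemma AlmostWellCovered.ncard_le_of_component (h : AlmostWellCovered G)
    (c : (G.induce (typeSet G 0)).ConnectedComponent) {S T : Set c.supp}
    (hS : IndepSet ((G.induce (typeSet G 0)).induce c.supp) S)
    (hdom : ∀ x, x ∈ S ∨ ∃ p ∈ S, ((G.induce (typeSet G 0)).induce c.supp).Adj p x)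
    (hT : IndepSet ((G.induce (typeSet G 0)).induce c.supp) T) :
    T.ncard ≤ S.ncard + 1 := by
  let f : c.supp → V := fun x ↦ x.1.1
  have hf : Function.Injective f := Subtype.val_injective.comp Subtype.val_injective
  rw [← Set.ncard_image_of_injective S hf, ← Set.ncard_image_of_injective T hf]
  refine h.ncard_le_of_exchange (P := {u | IsLeaf G u} ∪ f '' S) ?_ Set.subset_union_right ?_ ?_
  · rintro a (ha | ⟨a, ha, rfl⟩) b (hb | ⟨b, hb, rfl⟩) hab
    · exact IsLeaf.not_adj ha hb hab
    · exact HasType.not_adj_leaf b.1.2 ha hab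
    · exact HasType.not_adj_leaf a.1.2 hb hab.symm
    · exact hS ha hb hab
  · rintro _ ⟨a, ha, rfl⟩ _ ⟨b, hb, rfl⟩ hab
    exact hT ha hb hab
  · rintro _ ⟨t, ht, rfl⟩ x hx
    have hcomp : ∀ y : c.supp, f y ∈ f '' S ∨ ∃ p ∈ {u | IsLeaf G u} ∪ f '' S, G.Adj p (f y) := by
      intro y
      obtain hy | ⟨p, hp, hpy⟩ := hdom y
      · exact .inl ⟨y, hy, rfl⟩
      · exact .inr ⟨f p, .inr ⟨p, hp, rfl⟩, hpy⟩
    obtain rfl | hxt := hx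
    · exact hcomp t
    by_cases hx0 : HasType G x 0
    · refine hcomp ⟨⟨x, hx0⟩, ?_⟩
      have hadj : (G.induce (typeSet G 0)).Adj ⟨x, hx0⟩ t.1 := hxt
      exact (SimpleGraph.ConnectedComponent.sound hadj.reachable).trans t.2
    · obtain ⟨u, hu, hux⟩ := exists_leaf_adj_of_not_hasType_zero hx0
        fun hl ↦ HasType.not_adj_leaf t.1.2 hl hxt
      exact .inr ⟨u, .inl hu, hux⟩

end Types

section Classification

lemma cycleGraph_adj_iff_of_lt {n : ℕ} {u v : Fin n} (huv : u.val < v.val) :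
    (SimpleGraph.cycleGraph n).Adj u v ↔ u.val + 1 = v.val ∨ (u.val = 0 ∧ v.val + 1 = n) := by
  rw [SimpleGraph.cycleGraph_adj']
  have h₁ : (v - u).val = v.val - u.val := Fin.sub_val_of_le huv.le
  have h₂ : (u - v).val = n + u.val - v.val := Fin.coe_sub_iff_lt.2 huv
  omega

/-- A finite nonempty connected graph of maximum degree at most two is a path or a cycle. -/
theorem exists_iso_pathGraph_or_cycleGraph {W : Type*} [Finite W] {H : SimpleGraph W}
    (hH : H.Connected)
    (hdeg : ∀ v a b c, H.Adj v a → H.Adj v b → H.Adj v c → a = b ∨ b = c ∨ a = c) :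
    ∃ n, 1 ≤ n ∧ (Nonempty (H ≃g SimpleGraph.pathGraph n) ∨
      3 ≤ n ∧ Nonempty (H ≃g SimpleGraph.cycleGraph n)) := by
  classical
  have := Fintype.ofFinite W
  obtain ⟨w₀⟩ := hH.nonempty
  obtain ⟨m, ⟨u, v, p, hp, rfl⟩, hmax⟩ : ∃ m, (∃ u v, ∃ p : H.Walk u v, p.IsPath ∧ p.length = m) ∧
      ∀ u v, ∀ p : H.Walk u v, p.IsPath → p.length ≤ m := by
    let Q : ℕ → Prop := fun m ↦ ∃ u v, ∃ p : H.Walk u v, p.IsPath ∧ p.length = m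
    have hQ : ∀ u v, ∀ p : H.Walk u v, p.IsPath → p.length ≤ Fintype.card W :=
      fun u v p hp ↦ hp.length_lt.le
    have h0 : Q 0 := ⟨w₀, w₀, .nil, .nil, rfl⟩
    exact ⟨Nat.findGreatest Q (Fintype.card W), Nat.findGreatest_spec (P := Q) (Nat.zero_le _) h0,
      fun u v p hp ↦ Nat.le_findGreatest (hQ u v p hp) ⟨u, v, p, hp, rfl⟩⟩
  have hend : ∀ {u' v'} (q : H.Walk u' v'), q.IsPath → q.length = p.length →
      ∀ w, H.Adj u' w → w ∈ q.support := by
    intro u' v' q hq hlen w hw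
    by_contra hmem
    have := hmax _ _ (.cons hw.symm q) (hq.cons hmem)
    simp at this
    omega
  set m := p.length with hm
  set f : ℕ → W := p.getVert with hf
  have hinj : ∀ i j, i ≤ m → j ≤ m → f i = f j → i = j := fun i j hi hj ↦ hp.getVert_injOn hi hj
  have hstep : ∀ i, i < m → H.Adj (f i) (f (i + 1)) := fun i hi ↦ p.adj_getVert_succ hi
  have hclosed : ∀ i ≤ m, ∀ w, H.Adj (f i) w → ∃ j ≤ m, f j = w := by
    intro i hi w hw
    have hsupp : w ∈ p.support → ∃ j ≤ m, f j = w := fun h ↦ by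
      obtain ⟨j, hj, hjm⟩ := SimpleGraph.Walk.mem_support_iff_exists_getVert.1 h
      exact ⟨j, hjm, hj⟩
    rcases Nat.eq_zero_or_pos i with rfl | hi0
    · exact hsupp (hend p hp rfl w (by simpa [hf] using hw))
    obtain rfl | him := hi.eq_or_lt
    · have := hend p.reverse hp.reverse (by simp [hm]) w (by simpa [hf, hm] using hw)
      exact hsupp (by simpa using this)
    have h₁ := hstep (i - 1) (by omega)
    rw [Nat.sub_add_cancel hi0] at h₁
    obtain heq | heq | heq := hdeg _ _ _ _ h₁.symm (hstep i him) hw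
    · have := hinj _ _ (by omega) (by omega) heq
      omega
    · exact ⟨i + 1, him, heq⟩
    · exact ⟨i - 1, by omega, heq⟩
  have hsurj : ∀ w, ∃ j ≤ m, f j = w := by
    intro w
    have hr := (SimpleGraph.reachable_iff_reflTransGen _ _).1 (hH.preconnected (f 0) w)
    induction hr with
    | refl => exact ⟨0, Nat.zero_le _, rfl⟩
    | tail _ hbc ih =>
      obtain ⟨j, hj, rfl⟩ := ih
      exact hclosed j hj _ hbc
  have hadj : ∀ i j, i < j → j ≤ m → H.Adj (f i) (f j) → i + 1 = j ∨ (i = 0 ∧ j = m) := by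
    intro i j hij hj hA
    by_contra! hcon
    rcases Nat.eq_zero_or_pos i with rfl | hi0
    · have hjm : j < m := lt_of_le_of_ne hj (hcon.2 rfl)
      have h₁ := hstep (j - 1) (by omega)
      rw [Nat.sub_add_cancel (by omega)] at h₁
      obtain heq | heq | heq := hdeg _ _ _ _ h₁.symm (hstep j hjm) hA.symm <;>
        have := hinj _ _ (by omega) (by omega) heq <;> omega
    · have h₁ := hstep (i - 1) (by omega)
      rw [Nat.sub_add_cancel hi0] at h₁
      obtain heq | heq | heq := hdeg _ _ _ _ h₁.symm (hstep i (by omega)) hA <;>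
        have := hinj _ _ (by omega) (by omega) heq <;> omega
  let e : Fin (m + 1) ≃ W := Equiv.ofBijective (fun i ↦ f i)
    ⟨fun i j hij ↦ Fin.ext (hinj _ _ (by omega) (by omega) hij),
      fun w ↦ by
        obtain ⟨j, hj, hw⟩ := hsurj w
        exact ⟨⟨j, by omega⟩, hw⟩⟩
  have hiso : ∀ K : SimpleGraph (Fin (m + 1)),
      (∀ i j : Fin (m + 1), i.val < j.val → (H.Adj (f i) (f j) ↔ K.Adj i j)) →
      Nonempty (H ≃g K) := by
    intro K hK
    refine ⟨SimpleGraph.Iso.symm ⟨e, fun {i j} ↦ ?_⟩⟩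
    change H.Adj (f i) (f j) ↔ K.Adj i j
    rcases lt_trichotomy i.val j.val with hij | hij | hij
    · exact hK i j hij
    · obtain rfl := Fin.ext hij
      simp
    · rw [H.adj_comm, K.adj_comm]
      exact hK j i hij
  refine ⟨m + 1, by omega, ?_⟩
  by_cases hcyc : 2 ≤ m ∧ H.Adj (f 0) (f m)
  · refine .inr ⟨by omega, hiso _ fun i j hij ↦ ?_⟩
    rw [cycleGraph_adj_iff_of_lt hij]
    refine ⟨fun hA ↦ ?_, ?_⟩
    · have := hadj i j hij (by omega) hA
      omega
    · rintro (hj | ⟨hi, hj⟩)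
      · rw [← hj]
        exact hstep i (by omega)
      · rw [hi, show j.val = m by omega]
        exact hcyc.2
  · refine .inl (hiso _ fun i j hij ↦ ?_)
    rw [SimpleGraph.pathGraph_adj]
    refine ⟨fun hA ↦ ?_, ?_⟩
    · obtain hj | ⟨hi, hj⟩ := hadj i j hij (by omega) hA
      · exact .inl hj
      · rw [hi, hj] at hA
        have : ¬ 2 ≤ m := fun h ↦ hcyc ⟨h, hA⟩
        omega
    · rintro (hj | hj)
      · rw [← hj]
        exact hstep i (by omega)
      · omega

end Classification

section Bounds

/-- `H` has an independent dominating set `S` and an independent set `T` with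
`|S| ≤ s` and `t ≤ |T|`. -/
def HasIndepSizes {W : Type*} (H : SimpleGraph W) (s t : ℕ) : Prop :=
  ∃ S T : Set W, IndepSet H S ∧ (∀ x, x ∈ S ∨ ∃ p ∈ S, H.Adj p x) ∧ IndepSet H T ∧
    S.ncard ≤ s ∧ t ≤ T.ncard

lemma HasIndepSizes.of_iso {W W' : Type*} {H : SimpleGraph W} {K : SimpleGraph W'}
    (e : H ≃g K) {s t : ℕ} (h : HasIndepSizes K s t) : HasIndepSizes H s t := by
  obtain ⟨S, T, hS, hdom, hT, hs, ht⟩ := h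
  refine ⟨e.symm '' S, e.symm '' T, ?_, ?_, ?_, ?_, ?_⟩
  · rintro _ ⟨a, ha, rfl⟩ _ ⟨b, hb, rfl⟩ hab
    exact hS ha hb (e.symm.map_adj_iff.1 hab)
  · intro x
    obtain hx | ⟨p, hp, hpx⟩ := hdom (e x)
    · exact .inl ⟨e x, hx, e.symm_apply_apply x⟩
    · refine .inr ⟨e.symm p, ⟨p, hp, rfl⟩, ?_⟩
      rw [← e.map_adj_iff]
      simpa using hpx
  · rintro _ ⟨a, ha, rfl⟩ _ ⟨b, hb, rfl⟩ hab
    exact hT ha hb (e.symm.map_adj_iff.1 hab)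
  · rwa [Set.ncard_image_of_injective _ e.symm.injective]
  · rwa [Set.ncard_image_of_injective _ e.symm.injective]

lemma pathGraph_hasIndepSizes {n : ℕ} (hn : 1 ≤ n) :
    HasIndepSizes (SimpleGraph.pathGraph n) ((n + 2) / 3) ((n + 1) / 2) := by
  let f : Fin ((n + 2) / 3) → Fin n := fun k ↦ ⟨min (3 * k.val + 1) (n - 1), by omega⟩
  let g : Fin ((n + 1) / 2) → Fin n := fun k ↦ ⟨2 * k.val, by omega⟩
  refine ⟨Set.range f, Set.range g, ?_, ?_, ?_, ?_, ?_⟩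
  · rintro _ ⟨a, rfl⟩ _ ⟨b, rfl⟩ hab
    simp only [SimpleGraph.pathGraph_adj, f] at hab
    omega
  · intro x
    let y := f ⟨x.val / 3, by omega⟩
    have hy : y.val = min (3 * (x.val / 3) + 1) (n - 1) := rfl
    by_cases hxy : x.val = y.val
    · exact .inl ⟨_, (Fin.ext hxy).symm⟩
    · refine .inr ⟨y, ⟨_, rfl⟩, ?_⟩
      rw [SimpleGraph.pathGraph_adj]
      omega
  · rintro _ ⟨a, rfl⟩ _ ⟨b, rfl⟩ hab
    simp only [SimpleGraph.pathGraph_adj, g] at hab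
    omega
  · rw [← Set.image_univ]
    exact (Set.ncard_image_le).trans (by simp [Set.ncard_univ])
  · rw [← Set.image_univ, Set.ncard_image_of_injective _ fun i j hij ↦ ?_]
    · simp [Set.ncard_univ]
    · have := congrArg Fin.val hij
      simp only [g] at this
      omega

lemma cycleGraph_hasIndepSizes {n : ℕ} (hn : 3 ≤ n) :
    HasIndepSizes (SimpleGraph.cycleGraph n) ((n + 2) / 3) (n / 2) := by
  have hadj : ∀ u v : Fin n, (SimpleGraph.cycleGraph n).Adj u v ↔
      u.val + 1 = v.val ∨ v.val + 1 = u.val ∨ (u.val = 0 ∧ v.val + 1 = n) ∨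
        (v.val = 0 ∧ u.val + 1 = n) := by
    intro u v
    rcases lt_trichotomy u.val v.val with huv | huv | huv
    · rw [cycleGraph_adj_iff_of_lt huv]
      omega
    · obtain rfl := Fin.ext huv
      simp
      omega
    · rw [SimpleGraph.adj_comm, cycleGraph_adj_iff_of_lt huv]
      omega
  let f : Fin ((n + 2) / 3) → Fin n := fun k ↦ ⟨min (3 * k.val) (n - 2), by omega⟩
  let g : Fin (n / 2) → Fin n := fun k ↦ ⟨2 * k.val, by omega⟩
  refine ⟨Set.range f, Set.range g, ?_, ?_, ?_, ?_, ?_⟩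
  · rintro _ ⟨a, rfl⟩ _ ⟨b, rfl⟩ hab
    simp only [hadj, f] at hab
    omega
  · intro x
    by_cases hx : x.val + 1 = n ∧ n % 3 = 0
    · refine .inr ⟨f ⟨0, by omega⟩, ⟨_, rfl⟩, ?_⟩
      simp only [hadj, f]
      omega
    let y := f ⟨(x.val + 1) / 3, by omega⟩
    have hy : y.val = min (3 * ((x.val + 1) / 3)) (n - 2) := rfl
    by_cases hxy : x.val = y.val
    · exact .inl ⟨_, (Fin.ext hxy).symm⟩
    · refine .inr ⟨y, ⟨_, rfl⟩, ?_⟩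
      rw [hadj]
      omega
  · rintro _ ⟨a, rfl⟩ _ ⟨b, rfl⟩ hab
    simp only [hadj, g] at hab
    omega
  · rw [← Set.image_univ]
    exact (Set.ncard_image_le).trans (by simp [Set.ncard_univ])
  · rw [← Set.image_univ, Set.ncard_image_of_injective _ fun i j hij ↦ ?_]
    · simp [Set.ncard_univ]
    · have := congrArg Fin.val hij
      simp only [g] at this
      omega

end Bounds

/-- In an almost well-covered graph with no cycle of length 3, 4, 5, or 7
and no vertex of type 2, every component of `G₀` is isomorphic to one of the paths
`P₁,…,P₈,P₁₀` or one of the cycles `C₆,C₈,C₉,C₁₀,C₁₁,C₁₃`. -/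
theorem components_of_G0_no_type2 {V : Type*} [Fintype V] (G : SimpleGraph V)
    (h : AlmostWellCovered G)
    (h3 : NoCycleOfLength G 3) (h4 : NoCycleOfLength G 4)
    (h5 : NoCycleOfLength G 5) (h7 : NoCycleOfLength G 7)
    (hno2 : ∀ v : V, ¬ HasType G v 2)
    (c : (G.induce (typeSet G 0)).ConnectedComponent) :
    (∃ n ∈ ({1, 2, 3, 4, 5, 6, 7, 8, 10} : Set ℕ),
      Nonempty ((G.induce (typeSet G 0)).induce c.supp ≃g SimpleGraph.pathGraph n)) ∨
    (∃ n ∈ ({6, 8, 9, 10, 11, 13} : Set ℕ),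
      Nonempty ((G.induce (typeSet G 0)).induce c.supp ≃g SimpleGraph.cycleGraph n)) := by
  set H := (G.induce (typeSet G 0)).induce c.supp with hH
  have hconn : H.Connected := c.connected_toSimpleGraph
  have hdeg : ∀ v a b d, H.Adj v a → H.Adj v b → H.Adj v d → a = b ∨ b = d ∨ a = d := by
    intro v a b d ha hb hd
    have := h.eq_of_adj_type_zero h3 h4 h5 h7 a.1.2 b.1.2 d.1.2 ha hb hd
    simpa only [← Subtype.ext_iff] using this
  have hsizes : ∀ s t, HasIndepSizes H s t → t ≤ s + 1 := by
    rintro s t ⟨S, T, hS, hdom, hT, hs, ht⟩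
    have := h.ncard_le_of_component c hS hdom hT
    omega
  obtain ⟨n, hn, ⟨⟨e⟩⟩ | ⟨hn3, ⟨e⟩⟩⟩ := exists_iso_pathGraph_or_cycleGraph hconn hdeg
  · refine .inl ⟨n, ?_, ⟨e⟩⟩
    have := hsizes _ _ ((pathGraph_hasIndepSizes hn).of_iso e)
    simp only [Set.mem_insert_iff, Set.mem_singleton_iff]
    omega
  · refine .inr ⟨n, ?_, ⟨e⟩⟩
    have := hsizes _ _ ((cycleGraph_hasIndepSizes hn3).of_iso e)
    obtain ⟨v, w, hw, rfl⟩ := (SimpleGraph.cycleGraph_isContained_iff (G := G) hn3).1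
      ⟨(((SimpleGraph.Embedding.induce _).comp (SimpleGraph.Embedding.induce _)).comp
        e.symm.toEmbedding).toCopy⟩
    have := h3 v w hw
    have := h4 v w hw
    have := h5 v w hw
    have := h7 v w hw
    simp only [Set.mem_insert_iff, Set.mem_singleton_iff]
    omega
end

section
/- For every integer n ≥ 1, the path P_n on n vertices is well-covered if and only if n ∈ {1, 2, 4}, and P_n is almost well-covered if and only if n ∈ {3, 5, 6, 7, 8, 10}. For every integer n ≥ 3, the cycle C_n on n vertices is almost well-covered if and only if n ∈ {6, 8, 9, 10, 11, 13}. -/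
theorem alphaNum_eq {V : Type*} {G : SimpleGraph V} {k : ℕ} {s : Set V} (hs : IndepSet G s)
    (hk : s.ncard = k) (hle : ∀ t, IndepSet G t → t.ncard ≤ k) : alphaNum G = k := by
  refine IsGreatest.csSup_eq ⟨⟨s, hs, hk⟩, ?_⟩
  rintro _ ⟨t, ht, rfl⟩
  exact hle t ht

theorem iNum_eq {V : Type*} {G : SimpleGraph V} {k : ℕ} {s : Set V} (hs : MaxIndepSet G s)
    (hk : s.ncard = k) (hle : ∀ t, MaxIndepSet G t → k ≤ t.ncard) : iNum G = k := by
  refine IsLeast.csInf_eq ⟨⟨s, hs, hk⟩, ?_⟩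
  rintro _ ⟨t, ht, rfl⟩
  exact hle t ht

theorem maxIndepSet_iff {V : Type*} {G : SimpleGraph V} {s : Set V} :
    MaxIndepSet G s ↔ IndepSet G s ∧ ∀ v ∉ s, ∃ w ∈ s, G.Adj w v := by
  refine ⟨fun ⟨hs, hmax⟩ => ⟨hs, fun v hv => ?_⟩, fun ⟨hs, hdom⟩ => ⟨hs, fun t ht hst => ?_⟩⟩
  · by_contra! h
    have hins : IndepSet G (insert v s) := by
      rintro a (rfl | ha) b (rfl | hb)
      · exact G.irrefl
      · exact fun hab => h b hb hab.symm
      · exact h a ha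
      · exact hs ha hb
    exact hv (hmax _ hins (Set.subset_insert v s) ▸ Set.mem_insert v s)
  · refine hst.antisymm fun v hv => ?_
    by_contra hvs
    obtain ⟨w, hw, hadj⟩ := hdom v hvs
    exact ht (hst hw) hv hadj

/-- If all neighbours of a vertex are given by two functions, then each vertex of a maximal
independent set dominates at most three vertices. -/
theorem MaxIndepSet.card_le_three_mul_ncard {V : Type*} [Finite V] {G : SimpleGraph V} {s : Set V}
    (hs : MaxIndepSet G s) (f g : V → V) (hfg : ∀ w v, G.Adj w v → v = f w ∨ v = g w) :
    Nat.card V ≤ 3 * s.ncard := by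
  have hcover : (Set.univ : Set V) ⊆ s ∪ (f '' s ∪ g '' s) := by
    intro v _
    by_cases hv : v ∈ s
    · exact Or.inl hv
    obtain ⟨w, hw, hadj⟩ := (maxIndepSet_iff.1 hs).2 v hv
    rcases hfg w v hadj with rfl | rfl
    · exact Or.inr (Or.inl ⟨w, hw, rfl⟩)
    · exact Or.inr (Or.inr ⟨w, hw, rfl⟩)
  have h := Set.ncard_le_ncard hcover
  rw [Set.ncard_univ] at h
  have := Set.ncard_union_le s (f '' s ∪ g '' s)
  have := Set.ncard_union_le (f '' s) (g '' s)
  have := Set.ncard_image_le (f := f) s.toFinite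
  have := Set.ncard_image_le (f := g) s.toFinite
  omega

/-- An independent set is disjoint from its translate along edges. -/
theorem IndepSet.two_mul_ncard_le_card {V : Type*} [Finite V] {G : SimpleGraph V} {s : Set V}
    (hs : IndepSet G s) (f : V → V) (hf : Function.Injective f) (hadj : ∀ v, G.Adj v (f v)) :
    2 * s.ncard ≤ Nat.card V := by
  have hdisj : Disjoint s (f '' s) := by
    rw [Set.disjoint_right]
    rintro _ ⟨w, hw, rfl⟩ hfw
    exact hs hw hfw (hadj w)
  have h := Set.ncard_le_ncard (Set.subset_univ (s ∪ f '' s))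
  rw [Set.ncard_union_eq hdisj, Set.ncard_image_of_injective s hf, Set.ncard_univ] at h
  omega

theorem ncard_range_of_injective {V : Type*} {k : ℕ} {f : Fin k → V}
    (hf : Function.Injective f) : (Set.range f).ncard = k := by
  rw [← Set.image_univ, Set.ncard_image_of_injective _ hf, Set.ncard_univ, Nat.card_fin]

theorem cycleGraph_adj_iff_val {n : ℕ} (hn : 3 ≤ n) {u v : Fin n} :
    (SimpleGraph.cycleGraph n).Adj u v ↔ u.val + 1 = v.val ∨ v.val + 1 = u.val ∨
      (u.val = 0 ∧ v.val + 1 = n) ∨ (v.val = 0 ∧ u.val + 1 = n) := by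
  have hu := u.isLt
  have hv := v.isLt
  rw [SimpleGraph.cycleGraph_adj']
  simp only [Fin.sub_def]
  have h (a b : ℕ) (ha : a < n) (hb : b < n) :
      (n - b + a) % n = if b ≤ a then a - b else n - b + a := by
    split_ifs with hab
    · rw [show n - b + a = a - b + n by omega, Nat.add_mod_right, Nat.mod_eq_of_lt (by omega)]
    · exact Nat.mod_eq_of_lt (by omega)
  rw [h _ _ hu hv, h _ _ hv hu]
  split_ifs <;> omega

theorem alphaNum_pathGraph (n : ℕ) : alphaNum (SimpleGraph.pathGraph n) = (n + 1) / 2 := by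
  refine alphaNum_eq (s := Set.range fun i : Fin ((n + 1) / 2) => ⟨2 * i.val, by omega⟩)
    ?_ (ncard_range_of_injective ?_) fun t ht => ?_
  · rintro _ ⟨i, rfl⟩ _ ⟨j, rfl⟩
    simp only [SimpleGraph.pathGraph_adj]
    omega
  · intro i j hij
    simp only [Fin.mk.injEq] at hij
    omega
  · have h := Set.ncard_le_ncard_of_injOn (s := t) (t := (Finset.range ((n + 1) / 2) : Set ℕ))
      (fun v => v.val / 2) (fun v _ => by simp; omega) (fun v hv w hw hvw => ?_)
    · rwa [Set.ncard_coe_finset, Finset.card_range] at h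
    · have h1 := ht hv hw
      have h2 := ht hw hv
      simp only [SimpleGraph.pathGraph_adj] at h1 h2 hvw
      omega

theorem alphaNum_cycleGraph {n : ℕ} (hn : 3 ≤ n) :
    alphaNum (SimpleGraph.cycleGraph n) = n / 2 := by
  refine alphaNum_eq (s := Set.range fun i : Fin (n / 2) => ⟨2 * i.val + 1, by omega⟩)
    ?_ (ncard_range_of_injective ?_) fun t ht => ?_
  · rintro _ ⟨i, rfl⟩ _ ⟨j, rfl⟩
    simp only [cycleGraph_adj_iff_val hn]
    omega
  · intro i j hij
    simp only [Fin.mk.injEq] at hij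
    omega
  · have h := ht.two_mul_ncard_le_card
      (fun v => ⟨if v.val + 1 = n then 0 else v.val + 1, by split_ifs <;> omega⟩) ?_ ?_
    · rw [Nat.card_fin] at h
      omega
    · intro v w hvw
      simp only [Fin.mk.injEq] at hvw
      split_ifs at hvw <;> omega
    · intro v
      simp only [cycleGraph_adj_iff_val hn]
      split_ifs <;> omega

/-- The sparse maximal independent set `{1, 4, 7, …}` of a path, closed off by the last vertex. -/
def sparseVertex (n : ℕ) (i : Fin ((n + 2) / 3)) : Fin n :=
  ⟨min (3 * i.val + 1) (n - 1), by omega⟩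

theorem sparseVertex_injective (n : ℕ) : Function.Injective (sparseVertex n) := by
  intro i j hij
  simp only [sparseVertex, Fin.mk.injEq] at hij
  omega

theorem exists_pathGraph_adj_sparseVertex {n : ℕ} {v : Fin n}
    (hv : v ∉ Set.range (sparseVertex n)) :
    ∃ w ∈ Set.range (sparseVertex n), (SimpleGraph.pathGraph n).Adj w v := by
  have hlt : v.val / 3 < (n + 2) / 3 := by omega
  refine ⟨_, ⟨⟨v.val / 3, hlt⟩, rfl⟩, ?_⟩
  have hne : sparseVertex n ⟨v.val / 3, hlt⟩ ≠ v := fun h => hv ⟨_, h⟩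
  rw [Ne, Fin.ext_iff] at hne
  simp only [sparseVertex, SimpleGraph.pathGraph_adj] at hne ⊢
  omega

theorem iNum_pathGraph (n : ℕ) : iNum (SimpleGraph.pathGraph n) = (n + 2) / 3 := by
  refine iNum_eq (s := Set.range (sparseVertex n))
    (maxIndepSet_iff.2 ⟨?_, fun v hv => exists_pathGraph_adj_sparseVertex hv⟩)
    (ncard_range_of_injective (sparseVertex_injective n)) fun t ht => ?_
  · rintro _ ⟨i, rfl⟩ _ ⟨j, rfl⟩
    simp only [sparseVertex, SimpleGraph.pathGraph_adj]
    omega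
  · have h := ht.card_le_three_mul_ncard (fun v => ⟨min (v.val + 1) (n - 1), by omega⟩)
      (fun v => ⟨v.val - 1, by omega⟩) fun w v hwv => ?_
    · rw [Nat.card_fin] at h
      omega
    · simp only [SimpleGraph.pathGraph_adj, Fin.ext_iff] at hwv ⊢
      omega

theorem iNum_cycleGraph {n : ℕ} (hn : 3 ≤ n) :
    iNum (SimpleGraph.cycleGraph n) = (n + 2) / 3 := by
  refine iNum_eq (s := Set.range (sparseVertex n)) (maxIndepSet_iff.2 ⟨?_, fun v hv => ?_⟩)
    (ncard_range_of_injective (sparseVertex_injective n)) fun t ht => ?_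
  · rintro _ ⟨i, rfl⟩ _ ⟨j, rfl⟩
    simp only [sparseVertex, cycleGraph_adj_iff_val hn]
    omega
  · obtain ⟨w, hw, hwv⟩ := exists_pathGraph_adj_sparseVertex hv
    rw [SimpleGraph.pathGraph_adj] at hwv
    exact ⟨w, hw, (cycleGraph_adj_iff_val hn).2 (by tauto)⟩
  · have h := ht.card_le_three_mul_ncard
      (fun v => ⟨if v.val + 1 = n then 0 else v.val + 1, by split_ifs <;> omega⟩)
      (fun v => ⟨if v.val = 0 then n - 1 else v.val - 1, by split_ifs <;> omega⟩)
      fun w v hwv => ?_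
    · rw [Nat.card_fin] at h
      omega
    · simp only [cycleGraph_adj_iff_val hn, Fin.ext_iff] at hwv ⊢
      split_ifs <;> omega

/-- `Pₙ` (n ≥ 1) is well-covered iff `n ∈ {1,2,4}` and almost well-covered
iff `n ∈ {3,5,6,7,8,10}`; `Cₙ` (n ≥ 3) is almost well-covered iff `n ∈ {6,8,9,10,11,13}`. -/
theorem paths_cycles_well_covered_classification :
    (∀ n : ℕ, 1 ≤ n →
      (WellCovered (SimpleGraph.pathGraph n) ↔ n ∈ ({1, 2, 4} : Set ℕ)) ∧
      (AlmostWellCovered (SimpleGraph.pathGraph n) ↔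
        n ∈ ({3, 5, 6, 7, 8, 10} : Set ℕ))) ∧
    (∀ n : ℕ, 3 ≤ n →
      (AlmostWellCovered (SimpleGraph.cycleGraph n) ↔
        n ∈ ({6, 8, 9, 10, 11, 13} : Set ℕ))) := by
  refine ⟨fun n hn => ⟨?_, ?_⟩, fun n hn => ?_⟩
  · simp only [WellCovered, alphaNum_pathGraph, iNum_pathGraph, Set.mem_insert_iff,
      Set.mem_singleton_iff]
    omega
  · simp only [AlmostWellCovered, indepGap, alphaNum_pathGraph, iNum_pathGraph,
      Set.mem_insert_iff, Set.mem_singleton_iff]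
    omega
  · simp only [AlmostWellCovered, indepGap, alphaNum_cycleGraph hn, iNum_cycleGraph hn,
      Set.mem_insert_iff, Set.mem_singleton_iff]
    omega
end
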